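/- arXiv:2210.04687 — 10 statements merged into one kernel-verified Lean document; each statement's English description precedes it below -/
import Mathlib

section
/- Let θ ∈ [0,1) and suppose there is an integer J ≥ 1 such that 1 + 2cos(2π m_j θ) > 0 for all j ≥ J. Then the partial products ∏_{j=J}^{k} (1 + 2cos(2π m_j θ))/3 converge as k → ∞, and the limit is nonzero if and only if Σ_{k=J}^{∞} ‖m_k θ‖² < ∞, where ‖t‖ denotes the distance from t ∈ ℝ to the nearest integer. -/
/-- distance from a real number to the nearest integer -/
noncomputable def nint (t : ℝ) : ℝ := |t - round t|

theorem nint_sq_bounds_cos (t : ℝ) :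
    8 * nint t ^ 2 ≤ 1 - Real.cos (2 * Real.pi * t) ∧
      1 - Real.cos (2 * Real.pi * t) ≤ 2 * Real.pi ^ 2 * nint t ^ 2 := by
  have hc : Real.cos (2 * Real.pi * t) = Real.cos (2 * Real.pi * (t - round t)) := by
    rw [← Real.cos_sub_int_mul_two_pi _ (round t)]
    congr 1
    ring
  have hd : |t - round t| ≤ 1 / 2 := abs_sub_round t
  have hn : nint t ^ 2 = (t - round t) ^ 2 := by rw [nint, sq_abs]
  rw [hc, hn]
  set d := t - (round t : ℝ)
  have hpi := Real.pi_pos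
  constructor
  · have hx : |2 * Real.pi * d| ≤ Real.pi := by
      rw [abs_mul, abs_of_pos (by positivity : 0 < 2 * Real.pi)]
      nlinarith
    have h := Real.cos_le_one_sub_mul_cos_sq hx
    have e : 2 / Real.pi ^ 2 * (2 * Real.pi * d) ^ 2 = 8 * d ^ 2 := by
      field_simp
      ring
    linarith
  · have h := Real.one_sub_sq_div_two_le_cos (x := 2 * Real.pi * d)
    linarith [mul_pow (2 * Real.pi) d 2, mul_pow 2 Real.pi 2]

theorem antitone_prod_range {a : ℕ → ℝ} (ha : ∀ k, 0 ≤ a k) (ha1 : ∀ k, a k ≤ 1) :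
    Antitone (fun n => ∏ k ∈ Finset.range n, a k) := by
  refine antitone_nat_of_succ_le fun n => ?_
  rw [Finset.prod_range_succ]
  exact mul_le_of_le_one_right (Finset.prod_nonneg fun k _ => ha k) (ha1 n)

theorem summable_one_sub_of_tendsto_prod_pos {a : ℕ → ℝ} {l : ℝ} (ha : ∀ k, 0 < a k)
    (ha1 : ∀ k, a k ≤ 1)
    (hl : Filter.Tendsto (fun n => ∏ k ∈ Finset.range n, a k) Filter.atTop (nhds l))
    (hpos : 0 < l) : Summable (fun k => 1 - a k) := by
  have hanti := antitone_prod_range (fun k => (ha k).le) ha1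
  refine summable_of_sum_range_le (c := -Real.log l) (fun k => sub_nonneg.2 (ha1 k)) fun n => ?_
  have h1 : l ≤ ∏ k ∈ Finset.range n, a k := hanti.le_of_tendsto hl n
  have h2 := Real.log_le_log hpos h1
  rw [Real.log_prod (fun k _ => (ha k).ne')] at h2
  have h3 : ∑ k ∈ Finset.range n, (1 - a k) ≤ ∑ k ∈ Finset.range n, -Real.log (a k) :=
    Finset.sum_le_sum fun k _ => by linarith [Real.log_le_sub_one_of_pos (ha k)]
  rw [Finset.sum_neg_distrib] at h3
  linarith

theorem exists_tendsto_prod_and_ne_zero_iff {a : ℕ → ℝ} (ha : ∀ k, 0 < a k)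
    (ha1 : ∀ k, a k ≤ 1) :
    ∃ l, Filter.Tendsto (fun n => ∏ k ∈ Finset.range n, a k) Filter.atTop (nhds l) ∧
      (l ≠ 0 ↔ Summable (fun k => 1 - a k)) := by
  have hanti := antitone_prod_range (fun k => (ha k).le) ha1
  have hnn : ∀ n, 0 ≤ ∏ k ∈ Finset.range n, a k :=
    fun n => Finset.prod_nonneg fun k _ => (ha k).le
  have hl := tendsto_atTop_ciInf hanti ⟨0, by rintro _ ⟨n, rfl⟩; exact hnn n⟩
  refine ⟨_, hl, fun h => summable_one_sub_of_tendsto_prod_pos ha ha1 hl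
    (lt_of_le_of_ne (ge_of_tendsto' hl hnn) h.symm), fun hs => ?_⟩
  have hs' : Summable (fun k => ‖a k - 1‖) := by
    simpa [norm_sub_rev] using hs.norm
  have hm := multipliable_one_add_of_summable hs'
  have hne := tprod_one_add_ne_zero_of_summable (f := fun k => a k - 1)
    (fun k => by simpa using (ha k).ne') hs'
  have ht := hm.hasProd.tendsto_prod_nat
  simp only [add_sub_cancel] at ht hne
  rwa [tendsto_nhds_unique hl ht]

/-- If `θ ∈ [0,1)` and `1 + 2 cos(2π m_j θ) > 0` for all `j ≥ J`, then the
partial products `∏_{j=J}^{k} (1 + 2 cos(2π m_j θ))/3` converge as `k → ∞`, with nonzero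
limit iff `∑_{k ≥ J} ‖m_k θ‖² < ∞`. -/
theorem stmt_3 (m : ℕ → ℕ) (hpos : ∀ j, 1 ≤ j → 0 < m j)
    (θ : ℝ) (hθ : θ ∈ Set.Ico (0 : ℝ) 1) (J : ℕ) (hJ : 1 ≤ J)
    (hposJ : ∀ j, J ≤ j → 0 < 1 + 2 * Real.cos (2 * Real.pi * (m j : ℝ) * θ)) :
    ∃ l : ℝ,
      Filter.Tendsto (fun k : ℕ => ∏ j ∈ Finset.Icc J k,
          (1 + 2 * Real.cos (2 * Real.pi * (m j : ℝ) * θ)) / 3)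
        Filter.atTop (nhds l) ∧
      (l ≠ 0 ↔ Summable (fun k : ℕ => nint ((m (J + k) : ℝ) * θ) ^ 2)) := by
  set b : ℕ → ℝ := fun j => (1 + 2 * Real.cos (2 * Real.pi * (m j : ℝ) * θ)) / 3 with hb
  obtain ⟨l, hl, hiff⟩ := exists_tendsto_prod_and_ne_zero_iff (a := fun k => b (J + k))
    (fun k => div_pos (hposJ _ (Nat.le_add_right J k)) three_pos)
    (fun k => by
      simp only [hb]
      linarith [Real.cos_le_one (2 * Real.pi * (m (J + k) : ℝ) * θ)])
  refine ⟨l, ?_, hiff.trans ?_⟩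
  · refine (hl.comp (Filter.tendsto_sub_atTop_nat J |>.comp
      (Filter.tendsto_add_atTop_nat 1))).congr fun k => ?_
    simp only [Function.comp_apply]
    rw [← Finset.prod_Ico_eq_prod_range b J (k + 1), Finset.Ico_add_one_right_eq_Icc]
  · have hbd := fun k => nint_sq_bounds_cos ((m (J + k) : ℝ) * θ)
    simp only [← mul_assoc] at hbd
    constructor <;> intro hs
    · refine Summable.of_nonneg_of_le (fun k => sq_nonneg _) (fun k => ?_) hs
      simp only [hb]
      nlinarith [(hbd k).1, sq_nonneg (nint ((m (J + k) : ℝ) * θ))]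
    · refine Summable.of_nonneg_of_le (fun k => ?_) (fun k => ?_)
        (hs.mul_left (2 / 3 * (2 * Real.pi ^ 2)))
      · simp only [hb]
        linarith [Real.cos_le_one (2 * Real.pi * (m (J + k) : ℝ) * θ)]
      · simp only [hb]
        linarith [(hbd k).2]
end

section
/- For every θ ∈ [0,1), the sequence L_k(θ) = ∏_{j=1}^{k-1} (1 + 2cos(2π m_j θ))/3 converges as k → ∞ to a limit L(θ); moreover, if θ is irrational and Σ_{j≥1} ‖m_j θ‖² < ∞, then L(θ) ≠ 0. -/
/-- Partial products of real factors in `[-1/3, 1]` converge. -/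
theorem exists_tendsto_prod_range_of_mem_Icc {a : ℕ → ℝ} (ha : ∀ j, a j ∈ Set.Icc (-1 / 3) 1) :
    ∃ L : ℝ, Filter.Tendsto (fun n => ∏ j ∈ Finset.range n, a j) Filter.atTop (nhds L) := by
  set P : ℕ → ℝ := fun n => ∏ j ∈ Finset.range n, a j
  have hsucc : ∀ n, P (n + 1) = P n * a n := fun n => Finset.prod_range_succ a n
  have habs : Antitone fun n => |P n| := antitone_nat_of_succ_le fun n => by
    rw [hsucc, abs_mul]
    exact mul_le_of_le_one_right (abs_nonneg _)
      (abs_le.2 ⟨by linarith [(ha n).1], (ha n).2⟩)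
  -- A factor `a` in this range satisfies `|1 - a| ≤ 2 * (1 - |a|)`.
  have hsum : Antitone fun n => P n + 2 * |P n| := antitone_nat_of_succ_le fun n => by
    obtain ⟨h₁, h₂⟩ := ha n
    have hfac : |a n - 1| ≤ 2 * (1 - |a n|) := by
      rw [abs_of_nonpos (by linarith : a n - 1 ≤ 0)]
      rcases abs_cases (a n) with h | h <;> linarith
    have hstep : P n * (a n - 1) ≤ |P n| * (2 * (1 - |a n|)) :=
      (le_abs_self _).trans (by rw [abs_mul]; gcongr)
    rw [hsucc, abs_mul]
    linarith
  have habs_lim := tendsto_atTop_ciInf habs ⟨0, by rintro _ ⟨n, rfl⟩; exact abs_nonneg _⟩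
  have hsum_lim := tendsto_atTop_ciInf hsum
    ⟨0, by rintro _ ⟨n, rfl⟩; linarith [neg_abs_le (P n), abs_nonneg (P n)]⟩
  refine ⟨_, (hsum_lim.sub (habs_lim.const_mul 2)).congr fun n => ?_⟩
  ring

theorem cos_two_pi_mul_ge_one_sub_nint_sq (x : ℝ) :
    1 - 2 * Real.pi ^ 2 * nint x ^ 2 ≤ Real.cos (2 * Real.pi * x) := by
  have h := Real.one_sub_sq_div_two_le_cos (x := 2 * Real.pi * x - round x * (2 * Real.pi))
  rw [Real.cos_sub_int_mul_two_pi] at h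
  rw [nint, sq_abs]
  linarith

theorem one_add_two_mul_cos_two_pi_mul_ne_zero {x : ℝ} (hx : Irrational x) :
    1 + 2 * Real.cos (2 * Real.pi * x) ≠ 0 := by
  intro h
  have hcos : Real.cos (2 * Real.pi / 3) = Real.cos (2 * Real.pi * x) := by
    rw [show 2 * Real.pi / 3 = Real.pi - Real.pi / 3 by ring, Real.cos_pi_sub,
      Real.cos_pi_div_three]
    linarith
  have hpi := Real.pi_ne_zero
  obtain ⟨k, hk | hk⟩ := Real.cos_eq_cos_iff.1 hcos
  · refine hx ⟨k + 1 / 3, ?_⟩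
    push_cast
    field_simp at hk ⊢
    linarith
  · refine hx ⟨k - 1 / 3, ?_⟩
    push_cast
    field_simp at hk ⊢
    linarith

/-- For every `θ ∈ [0,1)`, the sequence
`L_k(θ) = ∏_{j=1}^{k-1} (1 + 2 cos(2π m_j θ))/3` converges to some `L(θ)`; moreover if `θ`
is irrational and `∑_{j ≥ 1} ‖m_j θ‖² < ∞`, then `L(θ) ≠ 0`. -/
theorem stmt_4 (m : ℕ → ℕ) (hpos : ∀ j, 1 ≤ j → 0 < m j)
    (hmono : ∀ j, 1 ≤ j → m j < m (j + 1))
    (hratio : ∀ j, 1 ≤ j → 3 * m j ≤ m (j + 1))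
    (θ : ℝ) (hθ : θ ∈ Set.Ico (0 : ℝ) 1) :
    ∃ L : ℝ,
      Filter.Tendsto (fun k : ℕ => ∏ j ∈ Finset.Icc 1 (k - 1),
          (1 + 2 * Real.cos (2 * Real.pi * (m j : ℝ) * θ)) / 3)
        Filter.atTop (nhds L) ∧
      (Irrational θ → Summable (fun j : ℕ => nint ((m (j + 1) : ℝ) * θ) ^ 2) → L ≠ 0) := by
  set a : ℕ → ℝ := fun j => (1 + 2 * Real.cos (2 * Real.pi * ((m (j + 1) : ℝ) * θ))) / 3 with ha
  obtain ⟨L, hL⟩ := exists_tendsto_prod_range_of_mem_Icc (a := a) fun j =>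
    ⟨by simp only [ha]; linarith [Real.neg_one_le_cos (2 * Real.pi * ((m (j + 1) : ℝ) * θ))],
      by simp only [ha]; linarith [Real.cos_le_one (2 * Real.pi * ((m (j + 1) : ℝ) * θ))]⟩
  refine ⟨L, ?_, fun hirr hsum => ?_⟩
  · refine (hL.comp (Filter.tendsto_sub_atTop_nat 1)).congr fun k => ?_
    rw [Function.comp_apply, ← Finset.Ico_add_one_right_eq_Icc, Finset.prod_Ico_eq_prod_range,
      Nat.add_sub_cancel]
    refine Finset.prod_congr rfl fun j _ => ?_
    rw [ha, add_comm 1 j, mul_assoc (2 * Real.pi)]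
  · have hdev : Summable fun j => ‖a j - 1‖ := by
      refine (hsum.mul_left (4 / 3 * Real.pi ^ 2)).of_nonneg_of_le (fun _ => norm_nonneg _)
        fun j => ?_
      have h₁ := Real.cos_le_one (2 * Real.pi * ((m (j + 1) : ℝ) * θ))
      have h₂ := cos_two_pi_mul_ge_one_sub_nint_sq ((m (j + 1) : ℝ) * θ)
      simp only [ha, Real.norm_eq_abs]
      rw [abs_of_nonpos (by linarith)]
      linarith
    have hne : ∀ j, 1 + (a j - 1) ≠ 0 := fun j => by
      rw [add_sub_cancel]
      exact div_ne_zero (one_add_two_mul_cos_two_pi_mul_ne_zero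
        (hirr.natCast_mul (hpos (j + 1) (by omega)).ne')) three_ne_zero
    have hprod := (multipliable_one_add_of_summable hdev).hasProd.tendsto_prod_nat
    have hlim := tendsto_nhds_unique hL (hprod.congr fun n => by simp only [add_sub_cancel])
    rw [hlim]
    exact tprod_one_add_ne_zero_of_summable hne hdev
end

section
/- Let S = (s_n)_{n≥1} be a good sequence whose spectrum Λ_S is countable. Then for every continuous (i.e., atomless) probability measure μ on S¹, (1/N) Σ_{n=1}^{N} |μ̂(s_n)|² converges to 0 as N → ∞. -/
open MeasureTheory

noncomputable instance : MeasurableSpace Circle := borel Circle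
instance : BorelSpace Circle := ⟨rfl⟩

/-- The quotient of two independent samples of an atomless measure on the circle almost surely
avoids any given countable set. -/
theorem ae_prod_div_notMem_of_countable (μ : Measure Circle) [IsProbabilityMeasure μ]
    (hμ : ∀ z : Circle, μ {z} = 0) {A : Set Circle} (hA : A.Countable) :
    ∀ᵐ p ∂(μ.prod μ), p.1 / p.2 ∉ A := by
  have key : ∀ a ∈ A, ∀ᵐ p ∂(μ.prod μ), p.1 / p.2 ≠ a := by
    intro a _
    have hm : MeasurableSet {p : Circle × Circle | p.1 / p.2 = a} :=
      (isClosed_eq (by fun_prop) continuous_const).measurableSet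
    have h : (μ.prod μ) {p : Circle × Circle | p.1 / p.2 = a} = 0 := by
      rw [Measure.measure_prod_null hm]
      refine Filter.Eventually.of_forall fun x => ?_
      refine measure_mono_null (fun y hy => ?_) (hμ (x / a))
      have hy' : x / y = a := hy
      simp [← hy']
    simpa [ae_iff] using h
  filter_upwards [(ae_ball_iff hA).2 key] with p hp hpA
  exact hp _ hpA rfl

/-- The squared modulus of a Fourier coefficient as a double integral. -/
theorem sq_norm_integral_circle_pow (μ : Measure Circle) [IsProbabilityMeasure μ] (k : ℕ) :
    ((‖∫ z : Circle, (z : ℂ) ^ k ∂μ‖ ^ 2 : ℝ) : ℂ)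
      = ∫ p : Circle × Circle, ((p.1 / p.2 : Circle) : ℂ) ^ k ∂(μ.prod μ) := by
  have h (p : Circle × Circle) : ((p.1 / p.2 : Circle) : ℂ) ^ k
      = (p.1 : ℂ) ^ k * (starRingEnd ℂ) ((p.2 : ℂ) ^ k) := by
    rw [map_pow, ← Circle.coe_inv_eq_conj, ← mul_pow, div_eq_mul_inv, Circle.coe_mul]
  simp_rw [h]
  rw [integral_prod_mul (fun z : Circle => (z : ℂ) ^ k)
    (fun z : Circle => (starRingEnd ℂ) ((z : ℂ) ^ k)), integral_conj, Complex.mul_conj']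
  push_cast
  rfl

/-- For a good sequence `S` with countable spectrum and any continuous
(atomless) probability measure `μ` on the circle, `(1/N) ∑_{n=1}^N |μ̂(s_n)|² → 0`. -/
theorem stmt_9 (s : ℕ → ℕ) (hs : StrictMono s) (h0 : 0 < s 0)
    (c : Circle → ℂ)
    (hc : ∀ z : Circle,
      Filter.Tendsto (fun N : ℕ => (N : ℂ)⁻¹ * ∑ n ∈ Finset.range N, (z : ℂ) ^ (s n))
        Filter.atTop (nhds (c z)))
    (hcount : {z : Circle | c z ≠ 0}.Countable)
    (μ : Measure Circle) [IsProbabilityMeasure μ] (hμ : ∀ z : Circle, μ {z} = 0) :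
    Filter.Tendsto (fun N : ℕ => (N : ℝ)⁻¹ * ∑ n ∈ Finset.range N,
        ‖∫ z : Circle, (z : ℂ) ^ (s n) ∂μ‖ ^ 2)
      Filter.atTop (nhds 0) := by
  have hcont (k : ℕ) : Continuous fun p : Circle × Circle => ((p.1 / p.2 : Circle) : ℂ) ^ k := by
    have h : Continuous fun p : Circle × Circle => p.1 / p.2 := by fun_prop
    exact (continuous_subtype_val.comp h).pow k
  have hint (k : ℕ) :
      Integrable (fun p : Circle × Circle => ((p.1 / p.2 : Circle) : ℂ) ^ k) (μ.prod μ) :=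
    Integrable.of_bound (hcont k).aestronglyMeasurable 1
      (Filter.Eventually.of_forall fun p => by
        simp only [norm_pow, Circle.norm_coe, one_pow, le_refl])
  have hlim : Filter.Tendsto
      (fun N : ℕ => ∫ p : Circle × Circle,
        (N : ℂ)⁻¹ * ∑ n ∈ Finset.range N, ((p.1 / p.2 : Circle) : ℂ) ^ (s n) ∂(μ.prod μ))
      Filter.atTop (nhds (∫ _ : Circle × Circle, (0 : ℂ) ∂(μ.prod μ))) := by
    refine tendsto_integral_of_dominated_convergence (fun _ => 1) (fun N => ?_)
      (integrable_const _) (fun N => Filter.Eventually.of_forall fun p => ?_) ?_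
    · exact (continuous_const.mul
        (continuous_finsetSum _ fun n _ => hcont (s n))).aestronglyMeasurable
    · have hsum : ‖∑ n ∈ Finset.range N, ((p.1 / p.2 : Circle) : ℂ) ^ (s n)‖ ≤ N := by
        refine (norm_sum_le _ _).trans (le_of_eq ?_)
        simp only [norm_pow, Circle.norm_coe, one_pow, Finset.sum_const, Finset.card_range,
          nsmul_eq_mul, mul_one]
      rw [norm_mul, norm_inv, Complex.norm_natCast]
      exact (mul_le_mul_of_nonneg_left hsum (by positivity)).trans inv_mul_le_one
    · filter_upwards [ae_prod_div_notMem_of_countable μ hμ hcount] with p hp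
      have h : c (p.1 / p.2) = 0 := by simpa using hp
      simpa only [h] using hc (p.1 / p.2)
  rw [integral_zero] at hlim
  refine Filter.Tendsto.congr (fun N => ?_) ((Complex.continuous_re.tendsto 0).comp hlim)
  rw [Function.comp_apply, integral_const_mul, integral_finsetSum _ fun n _ => hint (s n)]
  simp only [← sq_norm_integral_circle_pow]
  rw [← Complex.ofReal_sum, ← Complex.ofReal_natCast, ← Complex.ofReal_inv, ← Complex.ofReal_mul,
    Complex.ofReal_re]
end

section
/- Let (m_j)_{j≥1} be an increasing sequence of positive integers satisfying Σ_{j≥1} (m_j/m_{j+1})² < ∞. Then the subgroup H₂ = {e^{2iπθ} : θ ∈ [0,1), Σ_{j≥1} ‖m_j θ‖² < ∞} of the unit circle is uncountable. -/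
theorem nint_le_abs_sub (t : ℝ) (z : ℤ) : nint t ≤ |t - z| := round_le t z

/-- Among two consecutive fractions with denominator `q` just above `t`, one is at distance at
least `1 / (2 * q)` from a given point `x`. -/
theorem exists_int_div_near_of_far (t x : ℝ) {q : ℝ} (hq : 0 < q) :
    ∃ b : ℤ, t ≤ b / q ∧ b / q ≤ t + 2 / q ∧ 1 / (2 * q) ≤ |b / q - x| := by
  have h1 := Int.le_ceil (t * q)
  have h2 := Int.ceil_lt_add_one (t * q)
  set c := ⌈t * q⌉
  have hs : ∀ y : ℝ, |y / q - x| = |y - x * q| / q := fun y => by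
    rw [← abs_of_pos hq, ← abs_div, abs_of_pos hq]
    congr 1
    field_simp
  have hhalf : 1 / (2 * q) = (1 / 2) / q := by field_simp
  have hadd : t + 2 / q = (t * q + 2) / q := by field_simp
  rw [hhalf, hadd]
  by_cases h : 1 / 2 ≤ |(c : ℝ) - x * q|
  · refine ⟨c, by rwa [le_div_iff₀ hq], ?_, ?_⟩
    · gcongr
      linarith
    · rw [hs]
      gcongr
  · refine ⟨c + 1, ?_, ?_, ?_⟩
    · rw [le_div_iff₀ hq]
      push_cast
      linarith
    · gcongr
      push_cast
      linarith
    · rw [hs]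
      gcongr
      push_cast
      rw [not_le, abs_lt] at h
      rw [le_abs]
      left
      linarith

/-- For a sequence growing by a factor at least `10` at each step, one can find `θ ∈ [0, 1)` outside
a given countable set with `‖N k * θ‖` controlled by `N k / N (k + 1)`. -/
theorem exists_nint_mul_le_of_lacunary (N : ℕ → ℝ) (h0 : 10 ≤ N 0)
    (hN : ∀ k, 10 * N k ≤ N (k + 1)) (x : ℕ → ℝ) :
    ∃ θ ∈ Set.Ico (0 : ℝ) 1, (∀ k, θ ≠ x k) ∧
      ∀ k, nint (N k * θ) ≤ 3 * (N k / N (k + 1)) := by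
  have hpos : ∀ k, 0 < N k := fun k => by
    induction k with
    | zero => linarith
    | succ k ih => linarith [hN k]
  choose f hf using fun (k : ℕ) (a : ℤ) =>
    exists_int_div_near_of_far (a / N k) (x k) (hpos (k + 1))
  obtain ⟨a, ha_zero, ha⟩ : ∃ a : ℕ → ℤ, a 0 = 0 ∧ ∀ k, a (k + 1) = f k (a k) :=
    ⟨fun k => Nat.rec 0 f k, rfl, fun _ => rfl⟩
  have hlow : ∀ k, (a k : ℝ) / N k ≤ a (k + 1) / N (k + 1) := fun k => by
    rw [ha]
    exact (hf k (a k)).1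
  have hup : ∀ k, a (k + 1) / N (k + 1) ≤ a k / N k + 2 / N (k + 1) :=
    fun k => by
      rw [ha]
      exact (hf k (a k)).2.1
  have hfar : ∀ k, 1 / (2 * N (k + 1)) ≤ |a (k + 1) / N (k + 1) - x k| :=
    fun k => by
      rw [ha]
      exact (hf k (a k)).2.2
  have hinv : ∀ k, 10 * (1 / N (k + 1)) ≤ 1 / N k := fun k => by
    rw [mul_one_div, div_le_div_iff₀ (hpos _) (hpos k)]
    linarith [hN k]
  have hinv_pos : ∀ k, 0 < 1 / N k := fun k => one_div_pos.2 (hpos k)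
  have hmono : Monotone fun k => a k / N k := monotone_nat_of_le_succ hlow
  have hanti : Antitone fun k => a k / N k + 1 / N k / 4 := antitone_nat_of_succ_le fun k => by
    have h1 := hup k
    rw [← mul_one_div 2] at h1
    linarith [hinv k, hinv_pos (k + 1)]
  have hmem := Set.mem_iInter.1 (hmono.ciSup_mem_iInter_Icc_of_antitone hanti fun k => by
    linarith [hinv_pos k])
  set θ := ⨆ k, a k / N k
  have hge : ∀ k, a k / N k ≤ θ := fun k => (hmem k).1
  have hle : ∀ k, θ ≤ a k / N k + 1 / N k / 4 := fun k => (hmem k).2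
  have ha0 : (a 0 : ℝ) / N 0 = 0 := by simp [ha_zero]
  refine ⟨θ, ⟨ha0.symm.le.trans (hge 0), ?_⟩, fun k hk => ?_, fun k => ?_⟩
  · have h1 := hle 0
    have h2 : 1 / N 0 ≤ 1 := (div_le_one (hpos 0)).2 (by linarith)
    linarith
  · have h1 := hfar k
    have h2 : 1 / (2 * N (k + 1)) = 1 / N (k + 1) / 2 := by
      rw [div_div, mul_comm]
    rw [h2, ← hk, le_abs] at h1
    have := hge (k + 1)
    have := hle (k + 1)
    have := hinv_pos (k + 1)
    rcases h1 with h1 | h1 <;> linarith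
  · have h1 : θ - a k / N k ≤ 3 * (1 / N (k + 1)) := by
      have h1 := hup k
      rw [← mul_one_div 2] at h1
      linarith [hle (k + 1), hinv_pos (k + 1)]
    have h2 : N k * θ - a k = N k * (θ - a k / N k) := by
      have := (hpos k).ne'
      field_simp
    calc nint (N k * θ) ≤ |N k * θ - a k| := nint_le_abs_sub _ _
      _ = N k * (θ - a k / N k) := by
        rw [h2, abs_of_nonneg (mul_nonneg (hpos k).le (sub_nonneg.2 (hge k)))]
      _ ≤ N k * (3 * (1 / N (k + 1))) := mul_le_mul_of_nonneg_left h1 (hpos k).le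
      _ = 3 * (N k / N (k + 1)) := by ring

/-- The map `θ ↦ exp (2 * π * I * θ)` is injective on `[0, 1)`. -/
theorem injOn_exp_two_pi_I_mul_Ico :
    Set.InjOn (fun θ : ℝ => Complex.exp (2 * (Real.pi : ℂ) * Complex.I * (θ : ℂ)))
      (Set.Ico 0 1) := by
  intro s hs t ht hst
  obtain ⟨n, hn⟩ := Complex.exp_eq_exp_iff_exists_int.1 hst
  have h1 : (s : ℂ) = t + n := by
    apply mul_left_cancel₀ Complex.two_pi_I_ne_zero
    linear_combination hn
  have h2 : s = t + n := by exact_mod_cast h1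
  have h3 : n < 1 := by
    have : (n : ℝ) < 1 := by linarith [hs.2, ht.1]
    exact_mod_cast this
  have h4 : -1 < n := by
    have : (-1 : ℝ) < n := by linarith [hs.1, ht.2]
    exact_mod_cast this
  obtain rfl : n = 0 := by omega
  simpa using h2

/-- If `(m_j)` is an increasing sequence of positive integers with
`∑_j (m_j/m_{j+1})² < ∞`, then `H₂ = {e^{2iπθ} : θ ∈ [0,1), ∑_j ‖m_j θ‖² < ∞}` is
uncountable. -/
theorem stmt_10 (m : ℕ → ℕ) (hpos : ∀ j, 1 ≤ j → 0 < m j)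
    (hmono : ∀ j, 1 ≤ j → m j < m (j + 1))
    (hA1 : Summable (fun j : ℕ => ((m (j + 1) : ℝ) / (m (j + 2) : ℝ)) ^ 2)) :
    ¬ Set.Countable {z : ℂ | ∃ θ ∈ Set.Ico (0 : ℝ) 1,
        Summable (fun j : ℕ => nint ((m (j + 1) : ℝ) * θ) ^ 2) ∧
        z = Complex.exp (2 * (Real.pi : ℂ) * Complex.I * (θ : ℂ))} := by
  intro hcount
  have hS : {θ ∈ Set.Ico (0 : ℝ) 1 |
      Summable (fun j : ℕ => nint ((m (j + 1) : ℝ) * θ) ^ 2)}.Countable := by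
    refine Set.countable_of_injective_of_countable_image
      (injOn_exp_two_pi_I_mul_Ico.mono fun θ h => h.1) (hcount.mono ?_)
    rintro _ ⟨θ, ⟨hθ, hsum⟩, rfl⟩
    exact ⟨θ, hθ, hsum, rfl⟩
  have hm : ∀ j, (1 : ℝ) ≤ m (j + 1) := fun j => by exact_mod_cast hpos (j + 1) (by omega)
  obtain ⟨K, hK⟩ : ∃ K, ∀ j, K ≤ j → 10 * (m (j + 1) : ℝ) ≤ m (j + 2) := by
    obtain ⟨K, hK⟩ := Filter.eventually_atTop.1
      (hA1.tendsto_atTop_zero.eventually (gt_mem_nhds (show (0 : ℝ) < (1 / 10) ^ 2 by norm_num)))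
    refine ⟨K, fun j hj => ?_⟩
    have h1 := lt_of_pow_lt_pow_left₀ 2 (by norm_num) (hK j hj)
    rw [div_lt_iff₀ (by linarith [hm (j + 1)])] at h1
    linarith
  obtain ⟨x, hx⟩ := Set.countable_iff_exists_subset_range.1 hS
  obtain ⟨θ, hθ, hne, hle⟩ := exists_nint_mul_le_of_lacunary (fun k => m (k + (K + 1) + 1))
    (by simpa using (by linarith [hK K le_rfl, hm K] : (10 : ℝ) ≤ m (K + 2)))
    (fun k => by
      have := hK (k + (K + 1)) (by omega)
      rwa [show k + 1 + (K + 1) + 1 = k + (K + 1) + 2 by omega]) x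
  have hsum : Summable (fun j : ℕ => nint ((m (j + 1) : ℝ) * θ) ^ 2) := by
    rw [← summable_nat_add_iff (K + 1)]
    refine Summable.of_nonneg_of_le (fun k => sq_nonneg _) (fun k => ?_)
      (((summable_nat_add_iff (K + 1)).2 hA1).mul_left 9)
    have h1 := pow_le_pow_left₀ (abs_nonneg _) (hle k) 2
    rw [show k + 1 + (K + 1) + 1 = k + (K + 1) + 2 by omega, mul_pow] at h1
    norm_num at h1 ⊢
    exact h1
  obtain ⟨k, hk⟩ := hx ⟨hθ, hsum⟩
  exact hne k hk.symm
end

section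
/- Suppose (m_{j_k})_{k≥1} is a subsequence of (m_j)_{j≥1} with j_1 > 1 and m_j/m_{j-1} > 2^{k+2} for all j ≥ j_k. Then the map from {0,1}^{ℕ*} to the unit circle sending η = (η_k)_{k≥1} to e^{2iπ θ(η)}, where θ(η) = Σ_{k=1}^{∞} η_k/m_{j_k}, is injective. -/
section LacunarySeries

variable {a e : ℕ → ℝ}

lemma pow_three_mul_le (h3 : ∀ k, 3 * a k ≤ a (k + 1)) (k : ℕ) : 3 ^ k * a 0 ≤ a k := by
  induction k with
  | zero => simp
  | succ k ih => rw [pow_succ]; linarith [h3 k]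

lemma norm_div_lacunary_le (ha : 0 < a 0) (h3 : ∀ k, 3 * a k ≤ a (k + 1))
    (he : ∀ k, |e k| ≤ 1) (k : ℕ) : ‖e k / a k‖ ≤ (1 / a 0) * (1 / 3) ^ k := by
  have hk := pow_three_mul_le h3 k
  have h0 : 0 < 3 ^ k * a 0 := by positivity
  rw [Real.norm_eq_abs, abs_div, abs_of_pos (h0.trans_le hk)]
  calc |e k| / a k ≤ 1 / (3 ^ k * a 0) := div_le_div₀ zero_le_one (he k) h0 hk
    _ = (1 / a 0) * (1 / 3) ^ k := by rw [one_div_pow]; field_simp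

lemma hasSum_lacunary_majorant (c : ℝ) :
    HasSum (fun k : ℕ ↦ (1 / c) * (1 / 3 : ℝ) ^ k) (3 / 2 / c) := by
  have h := (hasSum_geometric_of_lt_one (r := (1 / 3 : ℝ)) (by norm_num)
    (by norm_num)).mul_left (1 / c)
  rwa [show 1 / c * (1 - 1 / 3 : ℝ)⁻¹ = 3 / 2 / c by ring] at h

lemma summable_div_lacunary (ha : 0 < a 0) (h3 : ∀ k, 3 * a k ≤ a (k + 1))
    (he : ∀ k, |e k| ≤ 1) : Summable fun k ↦ e k / a k :=
  (hasSum_lacunary_majorant (a 0)).summable.of_norm_bounded (norm_div_lacunary_le ha h3 he)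

lemma abs_tsum_div_lacunary_le (ha : 0 < a 0) (h3 : ∀ k, 3 * a k ≤ a (k + 1))
    (he : ∀ k, |e k| ≤ 1) : |∑' k, e k / a k| ≤ 3 / 2 / a 0 :=
  tsum_of_norm_bounded (hasSum_lacunary_majorant (a 0)) (norm_div_lacunary_le ha h3 he)

lemma eq_zero_of_tsum_div_lacunary_eq_zero (ha : 0 < a 0) (h3 : ∀ k, 3 * a k ≤ a (k + 1))
    {d : ℕ → ℤ} (hd : ∀ k, |d k| ≤ 1) (h : ∑' k, (d k : ℝ) / a k = 0) (k : ℕ) : d k = 0 := by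
  have he : ∀ k, |(d k : ℝ)| ≤ 1 := fun k ↦ by exact_mod_cast hd k
  have hpos : ∀ k, 0 < a k := fun k ↦
    lt_of_lt_of_le (by positivity) (pow_three_mul_le h3 k)
  induction k using Nat.strong_induction_on with
  | _ k ih =>
    have hs := summable_div_lacunary ha h3 he
    have hsplit := hs.sum_add_tsum_nat_add (k + 1)
    have hzero : ∑ i ∈ Finset.range k, (d i : ℝ) / a i = 0 :=
      Finset.sum_eq_zero fun i hi ↦ by simp [ih i (Finset.mem_range.mp hi)]
    rw [h, Finset.sum_range_succ, hzero, zero_add] at hsplit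
    have htail : |∑' i, (d (i + (k + 1)) : ℝ) / a (i + (k + 1))| ≤ 3 / 2 / a (0 + (k + 1)) :=
      abs_tsum_div_lacunary_le (a := fun i ↦ a (i + (k + 1)))
        (e := fun i ↦ (d (i + (k + 1)) : ℝ)) (hpos _)
        (fun i ↦ by simpa [add_right_comm] using h3 (i + (k + 1))) (fun i ↦ he _)
    have hbound : |(d k : ℝ)| / a k ≤ 3 / 2 / (3 * a k) := by
      calc |(d k : ℝ)| / a k = |(d k : ℝ) / a k| := by rw [abs_div, abs_of_pos (hpos k)]
        _ = |∑' i, (d (i + (k + 1)) : ℝ) / a (i + (k + 1))| := by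
          rw [eq_neg_of_add_eq_zero_left hsplit, abs_neg]
        _ ≤ 3 / 2 / a (0 + (k + 1)) := htail
        _ ≤ 3 / 2 / (3 * a k) := by
          rw [zero_add]
          have := hpos k
          exact div_le_div_of_nonneg_left (by norm_num) (by positivity) (h3 k)
    have hhalf : |(d k : ℝ)| ≤ 1 / 2 := by
      have := hpos k
      rw [div_le_iff₀ this] at hbound
      calc _ ≤ _ := hbound
        _ = 1 / 2 := by field_simp
    have hlt : |(d k : ℝ)| < 1 := by linarith
    exact Int.abs_lt_one_iff.mp (by exact_mod_cast hlt)

end LacunarySeries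

/-- For a subsequence `(m_{j_k})` with `j_1 > 1` and `m_j/m_{j-1} > 2^{k+2}`
for all `j ≥ j_k`, the map `η ↦ e^{2iπθ(η)}`, `θ(η) = ∑_k η_k/m_{j_k}`, is injective on
`{0,1}^{ℕ*}`. -/
theorem stmt_14 (m : ℕ → ℕ) (hpos : ∀ j, 1 ≤ j → 0 < m j)
    (hmono : ∀ j, 1 ≤ j → m j < m (j + 1))
    (hratio : ∀ j, 1 ≤ j → 3 * m j ≤ m (j + 1))
    (jj : ℕ → ℕ) (hjj : ∀ k, 1 ≤ k → jj k < jj (k + 1)) (hj1 : 1 < jj 1)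
    (hgap : ∀ k, 1 ≤ k → ∀ i, jj k ≤ i → 2 ^ (k + 2) * m (i - 1) < m i)
    (η η' : ℕ → ℕ) (hη : ∀ k, 1 ≤ k → η k ≤ 1) (hη' : ∀ k, 1 ≤ k → η' k ≤ 1)
    (heq : Complex.exp (2 * (Real.pi : ℂ) * Complex.I *
        ((∑' k : ℕ, (η (k + 1) : ℝ) / (m (jj (k + 1)) : ℝ) : ℝ) : ℂ))
      = Complex.exp (2 * (Real.pi : ℂ) * Complex.I *
        ((∑' k : ℕ, (η' (k + 1) : ℝ) / (m (jj (k + 1)) : ℝ) : ℝ) : ℂ))) :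
    ∀ k, 1 ≤ k → η k = η' k := by
  have hj : ∀ k, 1 ≤ k → 2 ≤ jj k := fun k hk ↦ by
    induction k, hk using Nat.le_induction with
    | base => exact hj1
    | succ k hk ih => have := hjj k hk; omega
  have hmle : ∀ i j, 1 ≤ i → i ≤ j → m i ≤ m j := fun i j hi hij ↦ by
    induction j, hij using Nat.le_induction with
    | base => exact le_rfl
    | succ j hij ih => exact ih.trans (hmono j (hi.trans hij)).le
  set a : ℕ → ℝ := fun k ↦ (m (jj (k + 1)) : ℝ) with ha_def
  have ha : 8 < a 0 := by
    have h1 := hgap 1 le_rfl (jj 1) le_rfl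
    have h2 := hpos (jj 1 - 1) (by omega)
    have h3 : 8 < m (jj 1) := by norm_num at h1; omega
    simp only [ha_def, zero_add]
    exact_mod_cast h3
  have ha0 : 0 < a 0 := by linarith
  have h3 : ∀ k, 3 * a k ≤ a (k + 1) := fun k ↦ by
    have h1 := hj (k + 1) (by omega)
    have h2 := hjj (k + 1) (by omega)
    have h4 := (hratio (jj (k + 1)) (by omega)).trans (hmle _ (jj (k + 1 + 1)) (by omega) h2)
    simp only [ha_def]
    exact_mod_cast h4
  have habs : ∀ ξ : ℕ → ℕ, (∀ k, 1 ≤ k → ξ k ≤ 1) → ∀ k, |(ξ (k + 1) : ℝ)| ≤ 1 := fun ξ hξ k ↦ by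
    rw [Nat.abs_cast]
    exact_mod_cast hξ (k + 1) (by omega)
  have hs := summable_div_lacunary ha0 h3 (habs η hη)
  have hs' := summable_div_lacunary ha0 h3 (habs η' hη')
  set d : ℕ → ℤ := fun k ↦ (η (k + 1) : ℤ) - η' (k + 1) with hd_def
  have hd : ∀ k, |d k| ≤ 1 := fun k ↦ by
    have h1 := hη (k + 1) (by omega)
    have h2 := hη' (k + 1) (by omega)
    rw [abs_le]
    constructor <;> simp only [hd_def] <;> omega
  have hsub : ∑' k, (d k : ℝ) / a k
      = ∑' k, (η (k + 1) : ℝ) / a k - ∑' k, (η' (k + 1) : ℝ) / a k := by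
    rw [← hs.tsum_sub hs']
    refine tsum_congr fun k ↦ ?_
    simp only [hd_def]
    push_cast
    ring
  obtain ⟨n, hn⟩ := Complex.exp_eq_exp_iff_exists_int.mp heq
  have hdiff : ∑' k, (η (k + 1) : ℝ) / a k - ∑' k, (η' (k + 1) : ℝ) / a k = n := by
    rw [mul_comm (n : ℂ), ← mul_add] at hn
    have hn' := mul_left_cancel₀ Complex.two_pi_I_ne_zero hn
    rw [sub_eq_iff_eq_add']
    exact_mod_cast hn'
  have hlt : |(n : ℝ)| < 1 := by
    rw [← hdiff, ← hsub]
    calc _ ≤ 3 / 2 / a 0 := abs_tsum_div_lacunary_le ha0 h3 fun k ↦ by exact_mod_cast hd k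
      _ < 1 := by rw [div_lt_one ha0]; linarith
  have hn0 : n = 0 := Int.abs_lt_one_iff.mp (by exact_mod_cast hlt)
  have hsum : ∑' k, (d k : ℝ) / a k = 0 := by rw [hsub, hdiff, hn0, Int.cast_zero]
  intro k hk
  obtain ⟨k, rfl⟩ := Nat.exists_eq_add_of_le' hk
  have := eq_zero_of_tsum_div_lacunary_eq_zero ha0 h3 hd hsum k
  simp only [hd_def] at this
  omega
end

section
/- There exist a good sequence (s_n)_{n≥1} and a continuous (atomless) probability measure μ on the unit circle S¹ such that the sequence ((1/N) Σ_{n=1}^{N} |μ̂(s_n)|²)_{N≥1} converges to a strictly positive number. -/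
open MeasureTheory

/-- The sum of `d_j * q j` over the `k` lowest ternary digits `d_j` of `t`. -/
def ternarySum (q : ℕ → ℕ) (k t : ℕ) : ℕ := ∑ j ∈ Finset.range k, t / 3 ^ j % 3 * q j

lemma ternarySum_mod (q : ℕ → ℕ) (k t : ℕ) : ternarySum q k (t % 3 ^ k) = ternarySum q k t := by
  refine Finset.sum_congr rfl fun j hj => ?_
  have hj : j < k := Finset.mem_range.1 hj
  obtain ⟨i, rfl⟩ : ∃ i, k = j + 1 + i := ⟨k - (j + 1), by omega⟩
  congr 1
  rw [pow_add, pow_succ, mul_assoc, Nat.mod_mul_right_div_self, Nat.mod_mul_right_mod]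

lemma ternarySum_le (q : ℕ → ℕ) (k t : ℕ) :
    ternarySum q k t ≤ 2 * ∑ j ∈ Finset.range k, q j := by
  rw [Finset.mul_sum]
  exact Finset.sum_le_sum fun j _ => Nat.mul_le_mul_right _ (by omega)

lemma ternarySum_succ_add (q : ℕ → ℕ) {k r d : ℕ} (hr : r < 3 ^ k) (hd : d < 3) :
    ternarySum q (k + 1) (3 ^ k * d + r) = ternarySum q k r + d * q k := by
  rw [ternarySum, Finset.sum_range_succ, ← ternarySum, ← ternarySum_mod, Nat.mul_add_mod,
    Nat.mod_eq_of_lt hr, Nat.mul_add_div (by positivity), Nat.div_eq_of_lt hr, add_zero,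
    Nat.mod_eq_of_lt hd]

lemma ternarySum_lt {q : ℕ → ℕ} (hq : ∀ k, 3 * ∑ j ∈ Finset.range k, q j < q k) (k : ℕ) :
    ∀ {t t' : ℕ}, t < t' → t' < 3 ^ k → ternarySum q k t < ternarySum q k t' := by
  induction k with
  | zero => intro t t' h h'; simp at h'; omega
  | succ k ih =>
    intro t t' h h'
    have hpos : 0 < 3 ^ k := by positivity
    have key : ∀ x < 3 ^ (k + 1),
        ternarySum q (k + 1) x = ternarySum q k (x % 3 ^ k) + x / 3 ^ k * q k := by
      intro x hx
      conv_lhs => rw [← Nat.div_add_mod x (3 ^ k)]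
      exact ternarySum_succ_add q (Nat.mod_lt _ hpos)
        ((Nat.div_lt_iff_lt_mul hpos).2 (by rwa [pow_succ'] at hx))
    rw [key t (h.trans h'), key t' h']
    rcases (Nat.div_le_div_right (c := 3 ^ k) h.le).eq_or_lt with he | hl
    · rw [he]
      have : t % 3 ^ k < t' % 3 ^ k := by
        have h1 := Nat.div_add_mod t (3 ^ k)
        have h2 := Nat.div_add_mod t' (3 ^ k)
        rw [he] at h1
        omega
      have := ih this (Nat.mod_lt _ hpos)
      omega
    · have h1 := ternarySum_le q k (t % 3 ^ k)
      have h2 : (t / 3 ^ k + 1) * q k ≤ t' / 3 ^ k * q k := Nat.mul_le_mul_right _ hl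
      have h3 := hq k
      rw [add_mul] at h2
      omega

lemma sum_pow_ternarySum {R : Type*} [CommSemiring R] (q : ℕ → ℕ) (z : R) (k : ℕ) :
    ∑ t ∈ Finset.range (3 ^ k), z ^ ternarySum q k t =
      ∏ j ∈ Finset.range k, (1 + z ^ q j + z ^ (2 * q j)) := by
  induction k with
  | zero => simp [ternarySum]
  | succ k ih =>
    have key : ∀ d < 3, ∑ r ∈ Finset.range (3 ^ k), z ^ ternarySum q (k + 1) (3 ^ k * d + r) =
        (∑ r ∈ Finset.range (3 ^ k), z ^ ternarySum q k r) * z ^ (d * q k) := by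
      intro d hd
      rw [Finset.sum_mul]
      refine Finset.sum_congr rfl fun r hr => ?_
      rw [ternarySum_succ_add q (Finset.mem_range.1 hr) hd, pow_add]
    have h0 := key 0 (by norm_num)
    have h1 := key 1 (by norm_num)
    have h2 := key 2 (by norm_num)
    simp only [mul_zero, zero_add, mul_one, zero_mul, pow_zero, one_mul] at h0 h1
    rw [mul_two] at h2
    rw [show 3 ^ (k + 1) = 3 ^ k + 3 ^ k + 3 ^ k by ring, Finset.sum_range_add,
      Finset.sum_range_add, Finset.prod_range_succ, ← ih, h0, h1, h2]
    ring

/-- Averages of `u` converge as soon as `u` can be replaced by a convergent sequence `w` without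
changing the sums over the blocks of length `3 ^ k` that tile `[9 ^ k, 9 ^ (k + 1))`. -/
lemma tendsto_average_of_blocks {u w : ℕ → ℂ} {c : ℂ} (hu : ∀ n, ‖u n‖ ≤ 1) (hw : ∀ n, ‖w n‖ ≤ 1)
    (hblock : ∀ k a, 3 ^ k ≤ a → a < 3 ^ (k + 2) →
      ∑ t ∈ Finset.range (3 ^ k), u (3 ^ k * a + t) = ∑ t ∈ Finset.range (3 ^ k), w (3 ^ k * a + t))
    (hc : Filter.Tendsto w Filter.atTop (nhds c)) :
    Filter.Tendsto (fun N : ℕ => (N : ℂ)⁻¹ * ∑ n ∈ Finset.range N, u n) Filter.atTop (nhds c) := by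
  set D : ℕ → ℂ := fun N => ∑ n ∈ Finset.range N, (u n - w n) with hD
  have hterm : ∀ n, ‖u n - w n‖ ≤ 2 := fun n =>
    (norm_sub_le _ _).trans (by linarith [hu n, hw n])
  have hstep : ∀ k i, i ≤ 3 ^ (k + 2) - 3 ^ k → D (3 ^ k * (3 ^ k + i)) = D (3 ^ k * 3 ^ k) := by
    intro k i
    induction i with
    | zero => simp
    | succ i ih =>
      intro hi
      rw [← ih (by omega), ← add_assoc, mul_add_one]
      simp only [hD]
      rw [Finset.sum_range_add, Finset.sum_sub_distrib (s := Finset.range (3 ^ k)),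
        hblock k (3 ^ k + i) (by omega) (by omega), sub_self, add_zero]
  have hstart : ∀ k, D (3 ^ k * 3 ^ k) = D 1 := by
    intro k
    induction k with
    | zero => simp
    | succ k ih =>
      rw [← ih, ← hstep k (3 ^ (k + 2) - 3 ^ k) le_rfl]
      congr 1
      rw [Nat.add_sub_cancel' (Nat.pow_le_pow_right (by norm_num) (by omega))]
      ring
  have hbound : ∀ N : ℕ, 0 < N → ‖D N‖ ≤ 4 * √N := by
    intro N hN
    set k := Nat.log 9 N with hk
    have h9 : ∀ m, 9 ^ m = 3 ^ m * 3 ^ m := fun m => by rw [← mul_pow]; norm_num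
    have h1 : 3 ^ k * 3 ^ k ≤ N := h9 k ▸ Nat.pow_log_le_self 9 hN.ne'
    have h2 : N < 3 ^ k * 3 ^ (k + 2) := by
      have := Nat.lt_pow_succ_log_self (b := 9) (by norm_num) N
      rw [← hk] at this
      calc N < 9 ^ (k + 1) := this
        _ = _ := by rw [h9]; ring
    have hpos : 0 < 3 ^ k := by positivity
    have h3 : 3 ^ k ≤ N / 3 ^ k := (Nat.le_div_iff_mul_le hpos).2 h1
    have h4 : N / 3 ^ k < 3 ^ (k + 2) := Nat.div_lt_of_lt_mul h2
    have h5 : D (3 ^ k * (N / 3 ^ k)) = D 1 := by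
      rw [← hstart k, ← hstep k (N / 3 ^ k - 3 ^ k) (by omega), Nat.add_sub_cancel' h3]
    have h6 : D N = D 1 + ∑ t ∈ Finset.range (N % 3 ^ k),
        (u (3 ^ k * (N / 3 ^ k) + t) - w (3 ^ k * (N / 3 ^ k) + t)) := by
      rw [← h5]
      conv_lhs => rw [← Nat.div_add_mod N (3 ^ k)]
      exact Finset.sum_range_add _ _ _
    have h7 : ‖D 1‖ ≤ 2 := by simpa [hD] using hterm 0
    have h8 : ‖∑ t ∈ Finset.range (N % 3 ^ k),
        (u (3 ^ k * (N / 3 ^ k) + t) - w (3 ^ k * (N / 3 ^ k) + t))‖ ≤ 2 * 3 ^ k := by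
      refine (norm_sum_le_of_le _ fun t _ => hterm _).trans ?_
      rw [Finset.sum_const, Finset.card_range, nsmul_eq_mul, mul_comm]
      have : ((N % 3 ^ k : ℕ) : ℝ) ≤ 3 ^ k := by exact_mod_cast (Nat.mod_lt _ hpos).le
      linarith
    have h10 : (3 : ℝ) ^ k ≤ √N := Real.le_sqrt_of_sq_le (by rw [sq]; exact_mod_cast h1)
    have h11 : (1 : ℝ) ≤ 3 ^ k := one_le_pow₀ (by norm_num)
    rw [h6]
    refine (norm_add_le _ _).trans ?_
    linarith
  have hD0 : Filter.Tendsto (fun N : ℕ => (N : ℂ)⁻¹ * D N) Filter.atTop (nhds 0) := by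
    have h0 : Filter.Tendsto (fun N : ℕ => 4 * (√(N : ℝ))⁻¹) Filter.atTop (nhds 0) := by
      have := (Real.tendsto_sqrt_atTop.comp tendsto_natCast_atTop_atTop).inv_tendsto_atTop
      simpa using this.const_mul (4 : ℝ)
    refine squeeze_zero_norm' ?_ h0
    filter_upwards [Filter.eventually_gt_atTop 0] with N hN
    have hN' : (0 : ℝ) < N := by exact_mod_cast hN
    rw [norm_mul, norm_inv, Complex.norm_natCast]
    calc (N : ℝ)⁻¹ * ‖D N‖ ≤ (N : ℝ)⁻¹ * (4 * √N) := by gcongr; exact hbound N hN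
      _ = 4 * (√(N : ℝ))⁻¹ := by
        have : √(N : ℝ) ≠ 0 := (Real.sqrt_pos.2 hN').ne'
        have h2 : √(N : ℝ) * √N = N := Real.mul_self_sqrt hN'.le
        field_simp
        rw [sq, h2]
  have := hD0.add hc.cesaro_smul
  rw [zero_add] at this
  refine this.congr fun N => ?_
  rw [Complex.real_smul, Complex.ofReal_inv, Complex.ofReal_natCast, ← mul_add,
    ← Finset.sum_add_distrib]
  simp

lemma exists_tendsto_prod_range {g : ℕ → ℝ} (h1 : ∀ j, -(1 / 3) ≤ g j) (h2 : ∀ j, g j ≤ 1) :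
    ∃ p : ℝ, Filter.Tendsto (fun k => ∏ j ∈ Finset.range k, g j) Filter.atTop (nhds p) ∧
      (p ≠ 0 → Filter.Tendsto g Filter.atTop (nhds 1)) := by
  set P : ℕ → ℝ := fun k => ∏ j ∈ Finset.range k, g j with hP
  have hsucc : ∀ k, P (k + 1) = P k * g k := fun k => Finset.prod_range_succ _ _
  have hg : ∀ j, |g j| ≤ 1 := fun j => abs_le.2 ⟨by linarith [h1 j], h2 j⟩
  have hanti : Antitone fun k => |P k| := antitone_nat_of_succ_le fun k => by
    rw [hsucc, abs_mul]
    exact mul_le_of_le_one_right (abs_nonneg _) (hg k)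
  obtain ⟨a, ha⟩ : ∃ a, Filter.Tendsto (fun k => |P k|) Filter.atTop (nhds a) :=
    ⟨_, tendsto_atTop_ciInf hanti ⟨0, by rintro _ ⟨k, rfl⟩; exact abs_nonneg _⟩⟩
  by_cases h0 : a = 0
  · subst h0
    exact ⟨0, (tendsto_zero_iff_abs_tendsto_zero _).2 ha, fun h => (h rfl).elim⟩
  have hapos : 0 < a := lt_of_le_of_ne (ge_of_tendsto' ha fun k => abs_nonneg _) (Ne.symm h0)
  have hPpos : ∀ k, 0 < |P k| := fun k => hapos.trans_le (hanti.le_of_tendsto ha k)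
  have habs : Filter.Tendsto (fun k => |g k|) Filter.atTop (nhds 1) := by
    have := (ha.comp (Filter.tendsto_add_atTop_nat 1)).div ha h0
    rw [div_self h0] at this
    refine this.congr fun k => ?_
    simp only [Function.comp, Pi.div_apply]
    rw [hsucc, abs_mul, mul_div_cancel_left₀ _ (hPpos k).ne']
  have hev : ∀ᶠ k in Filter.atTop, 0 < g k := by
    filter_upwards [habs.eventually_const_lt (show (1 / 3 : ℝ) < 1 by norm_num)] with k hk
    by_contra! hneg
    rw [abs_of_nonpos hneg] at hk
    linarith [h1 k]
  have hg1 : Filter.Tendsto g Filter.atTop (nhds 1) :=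
    habs.congr' (hev.mono fun k hk => abs_of_pos hk)
  obtain ⟨K, hK⟩ := Filter.eventually_atTop.1 hev
  have hsign : ∀ k ≥ K, P K / |P K| * |P k| = P k := by
    intro k hk
    induction k, hk using Nat.le_induction with
    | base => exact div_mul_cancel₀ _ (hPpos K).ne'
    | succ k hk ih => rw [hsucc, abs_mul, abs_of_pos (hK k hk), ← mul_assoc, ih]
  exact ⟨_, (ha.const_mul (P K / |P K|)).congr' (Filter.eventually_atTop.2 ⟨K, hsign⟩),
    fun _ => hg1⟩

/-- The start of the block containing `n`, among the blocks of length `3 ^ k` that tile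
`[9 ^ k, 9 ^ (k + 1))`. -/
def blockStart (n : ℕ) : ℕ := 3 ^ Nat.log 9 n * (n / 3 ^ Nat.log 9 n)

lemma blockStart_le (n : ℕ) : blockStart n ≤ n := Nat.mul_div_le _ _

lemma nine_pow_log_le_blockStart {n : ℕ} (hn : n ≠ 0) : 9 ^ Nat.log 9 n ≤ blockStart n := by
  have h : 9 ^ Nat.log 9 n = 3 ^ Nat.log 9 n * 3 ^ Nat.log 9 n := by rw [← mul_pow]; norm_num
  rw [h]
  refine Nat.mul_le_mul_left _ ((Nat.le_div_iff_mul_le (by positivity)).2 ?_)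
  exact h ▸ Nat.pow_log_le_self 9 hn

lemma log_le_blockStart (n : ℕ) : Nat.log 9 n ≤ blockStart n := by
  rcases eq_or_ne n 0 with rfl | hn
  · simp
  · exact (Nat.lt_pow_self (by norm_num)).le.trans (nine_pow_log_le_blockStart hn)

lemma log_mul_add {k a t : ℕ} (h1 : 3 ^ k ≤ a) (h2 : a < 3 ^ (k + 2)) (ht : t < 3 ^ k) :
    Nat.log 9 (3 ^ k * a + t) = k := by
  have h9 : ∀ m, 9 ^ m = 3 ^ m * 3 ^ m := fun m => by rw [← mul_pow]; norm_num
  refine Nat.log_eq_of_pow_le_of_lt_pow ?_ ?_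
  · rw [h9]
    exact (Nat.mul_le_mul_left _ h1).trans (Nat.le_add_right _ _)
  · calc 3 ^ k * a + t < 3 ^ k * (a + 1) := by rw [mul_add_one]; omega
      _ ≤ 3 ^ k * 3 ^ (k + 2) := Nat.mul_le_mul_left _ h2
      _ = 9 ^ (k + 1) := by rw [h9]; ring

lemma blockStart_mul_add {k a t : ℕ} (h1 : 3 ^ k ≤ a) (h2 : a < 3 ^ (k + 2)) (ht : t < 3 ^ k) :
    blockStart (3 ^ k * a + t) = 3 ^ k * a := by
  rw [blockStart, log_mul_add h1 h2 ht, Nat.mul_add_div (by positivity), Nat.div_eq_of_lt ht,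
    add_zero]

/-- On the block starting at `b`, of length `3 ^ k`, this sequence enumerates the integers
`q b + ∑ j < k, ε j * q j` with `ε j ∈ {-1, 0, 1}`. -/
def blockSeq (q : ℕ → ℕ) (n : ℕ) : ℕ :=
  q (blockStart n) + ternarySum q (Nat.log 9 n) n - ∑ j ∈ Finset.range (Nat.log 9 n), q j

section

variable {q : ℕ → ℕ}

lemma sum_log_le (q : ℕ → ℕ) (n : ℕ) :
    ∑ j ∈ Finset.range (Nat.log 9 n), q j ≤ ∑ j ∈ Finset.range (blockStart n), q j :=
  Finset.sum_le_sum_of_subset (Finset.range_subset_range.2 (log_le_blockStart n))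

lemma blockSeq_add_sum (hq : ∀ k, 3 * ∑ j ∈ Finset.range k, q j < q k) (n : ℕ) :
    blockSeq q n + ∑ j ∈ Finset.range (Nat.log 9 n), q j =
      q (blockStart n) + ternarySum q (Nat.log 9 n) n := by
  have h1 := sum_log_le q n
  have h2 := hq (blockStart n)
  rw [blockSeq]
  omega

lemma blockSeq_pos (hq : ∀ k, 3 * ∑ j ∈ Finset.range k, q j < q k) (n : ℕ) :
    0 < blockSeq q n := by
  have h1 := sum_log_le q n
  have h2 := hq (blockStart n)
  have h3 := blockSeq_add_sum hq n
  omega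

lemma strictMono_blockSeq (hq : ∀ k, 3 * ∑ j ∈ Finset.range k, q j < q k) :
    StrictMono (blockSeq q) := by
  refine strictMono_nat_of_lt_succ fun n => ?_
  have e1 := blockSeq_add_sum hq n
  have e2 := blockSeq_add_sum hq (n + 1)
  have hlater : blockStart n < blockStart (n + 1) → blockSeq q n < blockSeq q (n + 1) := by
    intro h
    have h1 := sum_log_le q n
    have h2 := sum_log_le q (n + 1)
    have h3 : ∑ j ∈ Finset.range (blockStart n + 1), q j ≤
        ∑ j ∈ Finset.range (blockStart (n + 1)), q j :=
      Finset.sum_le_sum_of_subset (Finset.range_subset_range.2 h)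
    rw [Finset.sum_range_succ] at h3
    have h4 := hq (blockStart (n + 1))
    have h5 := ternarySum_le q (Nat.log 9 n) n
    omega
  rcases (Nat.log_mono_right (b := 9) n.le_succ).eq_or_lt with hk | hk
  · rw [Nat.succ_eq_add_one] at hk
    set k := Nat.log 9 n with hkn
    have hpos : 0 < 3 ^ k := by positivity
    rcases (Nat.div_le_div_right (c := 3 ^ k) n.le_succ).eq_or_lt with hd | hd
    · have hb : blockStart (n + 1) = blockStart n := by
        rw [blockStart, blockStart, ← hk, ← hkn, hd]
      rw [← hk, hb, ← ternarySum_mod] at e2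
      rw [← ternarySum_mod] at e1
      have hlt : n % 3 ^ k < (n + 1) % 3 ^ k := by
        have h1 := Nat.div_add_mod n (3 ^ k)
        have h2 := Nat.div_add_mod (n + 1) (3 ^ k)
        rw [hd, Nat.succ_eq_add_one] at h1
        omega
      have := ternarySum_lt hq k hlt (Nat.mod_lt _ hpos)
      omega
    · refine hlater ?_
      rw [blockStart, blockStart, ← hk, ← hkn]
      exact Nat.mul_lt_mul_of_pos_left hd hpos
  · refine hlater ((blockStart_le n).trans_lt ?_)
    calc n < 9 ^ (Nat.log 9 n + 1) := Nat.lt_pow_succ_log_self (by norm_num) n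
      _ ≤ 9 ^ Nat.log 9 (n + 1) := Nat.pow_le_pow_right (by norm_num) hk
      _ ≤ _ := nine_pow_log_le_blockStart n.succ_ne_zero

lemma tendsto_log : Filter.Tendsto (Nat.log 9) Filter.atTop Filter.atTop :=
  Filter.tendsto_atTop.2 fun k => (Filter.eventually_ge_atTop (9 ^ k)).mono fun n hn =>
    Nat.le_log_of_pow_le (by norm_num) hn

lemma tendsto_blockStart : Filter.Tendsto blockStart Filter.atTop Filter.atTop :=
  Filter.tendsto_atTop_mono log_le_blockStart tendsto_log

/-- The mean of `1`, `z ^ m` and `z ^ (-m)`. -/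
noncomputable def cosMean (m : ℕ) (z : Circle) : ℝ := (1 + 2 * ((z : ℂ) ^ m).re) / 3

lemma abs_re_pow_le (m : ℕ) (z : Circle) : |((z : ℂ) ^ m).re| ≤ 1 :=
  (Complex.abs_re_le_norm _).trans (by simp [Circle.norm_coe])

lemma neg_third_le_cosMean (m : ℕ) (z : Circle) : -(1 / 3) ≤ cosMean m z := by
  have := (abs_le.1 (abs_re_pow_le m z)).1
  rw [cosMean]; linarith

lemma cosMean_le_one (m : ℕ) (z : Circle) : cosMean m z ≤ 1 := by
  have := (abs_le.1 (abs_re_pow_le m z)).2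
  rw [cosMean]; linarith

lemma one_add_pow_add_pow (m : ℕ) (z : Circle) :
    1 + (z : ℂ) ^ m + (z : ℂ) ^ (2 * m) = 3 * (z : ℂ) ^ m * cosMean m z := by
  have h1 : (z : ℂ) ^ m * (starRingEnd ℂ) ((z : ℂ) ^ m) = 1 := by
    rw [Complex.mul_conj, Complex.normSq_eq_norm_sq]; simp [Circle.norm_coe]
  have h2 : ((cosMean m z : ℝ) : ℂ) = (1 + ((z : ℂ) ^ m + (starRingEnd ℂ) ((z : ℂ) ^ m))) / 3 := by
    rw [cosMean, Complex.add_conj]; push_cast; ring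
  rw [h2, pow_mul', sq]
  linear_combination -h1

lemma sum_pow_blockSeq (hq : ∀ k, 3 * ∑ j ∈ Finset.range k, q j < q k) (z : Circle)
    {k a : ℕ} (h1 : 3 ^ k ≤ a) (h2 : a < 3 ^ (k + 2)) :
    ∑ t ∈ Finset.range (3 ^ k), (z : ℂ) ^ blockSeq q (3 ^ k * a + t) =
      3 ^ k * ((z : ℂ) ^ q (3 ^ k * a) * ∏ j ∈ Finset.range k, (cosMean (q j) z : ℂ)) := by
  have hne : (z : ℂ) ^ (∑ j ∈ Finset.range k, q j) ≠ 0 := pow_ne_zero _ z.coe_ne_zero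
  refine mul_right_cancel₀ hne ?_
  rw [Finset.sum_mul]
  have hterm : ∀ t ∈ Finset.range (3 ^ k),
      (z : ℂ) ^ blockSeq q (3 ^ k * a + t) * (z : ℂ) ^ (∑ j ∈ Finset.range k, q j) =
        (z : ℂ) ^ q (3 ^ k * a) * (z : ℂ) ^ ternarySum q k t := by
    intro t ht
    have ht := Finset.mem_range.1 ht
    have := blockSeq_add_sum hq (3 ^ k * a + t)
    rw [log_mul_add h1 h2 ht, blockStart_mul_add h1 h2 ht, ← ternarySum_mod, Nat.mul_add_mod,
      ternarySum_mod] at this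
    rw [← pow_add, this, pow_add]
  rw [Finset.sum_congr rfl hterm, ← Finset.mul_sum, sum_pow_ternarySum,
    Finset.prod_congr rfl fun j _ => one_add_pow_add_pow (q j) z, Finset.prod_mul_distrib,
    Finset.prod_mul_distrib, Finset.prod_pow_eq_pow_sum, Finset.prod_const, Finset.card_range]
  ring

lemma tendsto_average_blockSeq (hq : ∀ k, 3 * ∑ j ∈ Finset.range k, q j < q k) (z : Circle) :
    ∃ p : ℝ, Filter.Tendsto (fun k => ∏ j ∈ Finset.range k, cosMean (q j) z)
        Filter.atTop (nhds p) ∧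
      Filter.Tendsto (fun N : ℕ => (N : ℂ)⁻¹ * ∑ n ∈ Finset.range N, (z : ℂ) ^ blockSeq q n)
        Filter.atTop (nhds p) := by
  obtain ⟨p, hp, hp1⟩ := exists_tendsto_prod_range
    (fun j => neg_third_le_cosMean (q j) z) (fun j => cosMean_le_one (q j) z)
  refine ⟨p, hp, ?_⟩
  refine tendsto_average_of_blocks (w := fun n => (z : ℂ) ^ q (blockStart n) *
    ∏ j ∈ Finset.range (Nat.log 9 n), (cosMean (q j) z : ℂ))
    (fun n => by simp [Circle.norm_coe]) (fun n => ?_)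
    (fun k a h1 h2 => ?_) ?_
  · rw [norm_mul, norm_pow, Circle.norm_coe, one_pow, one_mul, norm_prod]
    refine Finset.prod_le_one (fun _ _ => norm_nonneg _) fun j _ => ?_
    rw [Complex.norm_real, Real.norm_eq_abs, abs_le]
    exact ⟨by linarith [neg_third_le_cosMean (q j) z], cosMean_le_one _ _⟩
  · rw [sum_pow_blockSeq hq z h1 h2]
    symm
    rw [Finset.sum_congr rfl fun t ht => by
      rw [blockStart_mul_add h1 h2 (Finset.mem_range.1 ht),
        log_mul_add h1 h2 (Finset.mem_range.1 ht)]]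
    simp
  · have hP : Filter.Tendsto (fun n => ∏ j ∈ Finset.range (Nat.log 9 n), (cosMean (q j) z : ℂ))
        Filter.atTop (nhds (p : ℂ)) := by
      have := (Complex.continuous_ofReal.tendsto p).comp (hp.comp tendsto_log)
      exact this.congr fun n => by simp
    rcases eq_or_ne p 0 with rfl | hp0
    · refine squeeze_zero_norm (fun n => le_of_eq ?_) (tendsto_zero_iff_norm_tendsto_zero.1 hP)
      simp [Circle.norm_coe]
    · have hre : Filter.Tendsto (fun j => ((z : ℂ) ^ q j).re) Filter.atTop (nhds 1) := by
        have := (((hp1 hp0).const_mul 3).sub_const 1).div_const 2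
        norm_num at this
        exact this.congr fun j => by rw [cosMean]; ring
      have hz : Filter.Tendsto (fun j => (z : ℂ) ^ q j) Filter.atTop (nhds 1) := by
        rw [tendsto_iff_norm_sub_tendsto_zero]
        have h0 := ((hre.const_sub 1).const_mul 2).sqrt
        simp only [sub_self, mul_zero, Real.sqrt_zero] at h0
        refine h0.congr fun j => ?_
        rw [Real.sqrt_eq_iff_mul_self_eq (by linarith [(abs_le.1 (abs_re_pow_le (q j) z)).2])
          (norm_nonneg _), ← sq, ← Complex.normSq_eq_norm_sq, Complex.normSq_sub,
          Complex.normSq_eq_norm_sq]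
        simp [Circle.norm_coe]
        ring
      simpa using (hz.comp tendsto_blockStart).mul hP

end

/-- A superlinearly growing sequence of exponents. -/
def gapExp (j : ℕ) : ℕ := j ^ 2 + 5 * j + 1

lemma three_mul_sum_two_pow_gapExp_lt (k : ℕ) :
    3 * ∑ j ∈ Finset.range k, 2 ^ gapExp j < 2 ^ gapExp k := by
  induction k with
  | zero => simp
  | succ k ih =>
    have h : 2 ^ (gapExp k + 2) ≤ 2 ^ gapExp (k + 1) :=
      Nat.pow_le_pow_right (by norm_num) (by simp only [gapExp]; nlinarith)
    rw [pow_add] at h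
    rw [Finset.sum_range_succ]
    omega

/-- The real number whose binary digits at the positions `gapExp j` are `ε j`, the others being
zero. -/
noncomputable def gapReal (ε : ℕ → Bool) : ℝ :=
  ∑' j, if ε j then (1 / 2 : ℝ) ^ gapExp j else 0

lemma gapReal_term_nonneg (ε : ℕ → Bool) (j : ℕ) :
    0 ≤ if ε j then (1 / 2 : ℝ) ^ gapExp j else 0 := by split_ifs <;> positivity

lemma gapReal_term_le (ε : ℕ → Bool) (j : ℕ) :
    (if ε j then (1 / 2 : ℝ) ^ gapExp j else 0) ≤ (1 / 2) ^ j := by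
  split_ifs
  · exact pow_le_pow_of_le_one (by norm_num) (by norm_num) (by simp only [gapExp]; nlinarith)
  · positivity

lemma summable_gapReal (ε : ℕ → Bool) :
    Summable fun j => if ε j then (1 / 2 : ℝ) ^ gapExp j else 0 :=
  summable_geometric_two.of_nonneg_of_le (gapReal_term_nonneg ε) (gapReal_term_le ε)

lemma continuous_gapReal : Continuous gapReal := by
  refine continuous_tsum (fun j => ?_) summable_geometric_two fun j ε => ?_
  · exact (continuous_of_discreteTopology
      (f := fun b : Bool => if b then (1 / 2 : ℝ) ^ gapExp j else 0)).comp (continuous_apply j)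
  · rw [Real.norm_of_nonneg (gapReal_term_nonneg ε j)]
    exact gapReal_term_le ε j

lemma two_pow_mul_gapReal (ε : ℕ → Bool) (m : ℕ) :
    ∃ (n : ℕ) (t : ℝ), 0 ≤ t ∧ t ≤ (1 / 2) ^ (m + 5) ∧
      2 ^ gapExp m * gapReal ε = 2 * n + (if ε m then 1 else 0) + t := by
  refine ⟨∑ j ∈ Finset.range m, if ε j then 2 ^ (gapExp m - gapExp j - 1) else 0,
    2 ^ gapExp m * ∑' i, if ε (i + (m + 1)) then (1 / 2 : ℝ) ^ gapExp (i + (m + 1)) else 0,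
    mul_nonneg (by positivity) (tsum_nonneg fun i => gapReal_term_nonneg ε _), ?_, ?_⟩
  · rw [← tsum_mul_left]
    have hgeo : HasSum (fun i : ℕ => (1 / 2 : ℝ) ^ (m + 6) * (1 / 2) ^ i) ((1 / 2) ^ (m + 5)) := by
      have := hasSum_geometric_two.mul_left ((1 / 2 : ℝ) ^ (m + 6))
      rwa [show (1 / 2 : ℝ) ^ (m + 6) * 2 = (1 / 2) ^ (m + 5) by rw [pow_succ _ (m + 5)]; ring]
        at this
    rw [← hgeo.tsum_eq]
    refine Summable.tsum_le_tsum (fun i => ?_)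
      (((summable_nat_add_iff (m + 1)).2 (summable_gapReal ε)).mul_left _) hgeo.summable
    split_ifs
    · rw [← pow_add]
      calc (2 : ℝ) ^ gapExp m * (1 / 2) ^ gapExp (i + (m + 1))
          ≤ 2 ^ gapExp m * (1 / 2) ^ (gapExp m + (m + 6 + i)) := by
            gcongr ?_ * ?_
            exact pow_le_pow_of_le_one (by norm_num) (by norm_num)
              (by simp only [gapExp]; nlinarith)
        _ = (1 / 2) ^ (m + 6 + i) := by
            rw [pow_add, ← mul_assoc, ← mul_pow]; norm_num
    · rw [mul_zero]; positivity
  · have hinv : ∀ k : ℕ, (2 : ℝ) ^ k * (1 / 2) ^ k = 1 := fun k => by rw [← mul_pow]; norm_num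
    rw [gapReal, ← (summable_gapReal ε).sum_add_tsum_nat_add (m + 1), Finset.sum_range_succ,
      mul_add, mul_add, Finset.mul_sum, Nat.cast_sum, Finset.mul_sum]
    congr 2
    · refine Finset.sum_congr rfl fun j hj => ?_
      have hj := Finset.mem_range.1 hj
      split_ifs
      · have h : gapExp m = gapExp m - gapExp j - 1 + 1 + gapExp j := by
          have : gapExp j + 1 ≤ gapExp m := by simp only [gapExp]; nlinarith
          omega
        conv_lhs => rw [h, pow_add, mul_assoc, hinv]
        push_cast
        ring
      · simp
    · split_ifs
      · exact hinv _
      · simp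

/-- A Cantor set on the circle. -/
noncomputable def gapPoint (ε : ℕ → Bool) : Circle := Circle.exp (2 * Real.pi * gapReal ε)

lemma continuous_gapPoint : Continuous gapPoint :=
  Circle.exp.continuous.comp (continuous_const.mul continuous_gapReal)

lemma norm_exp_sub_one_le (x : ℝ) : ‖(Circle.exp x : ℂ) - 1‖ ≤ |x| := by
  rw [Circle.coe_exp, mul_comm]
  exact Real.norm_exp_I_mul_ofReal_sub_one_le

lemma norm_gapPoint_pow_sub_one_le (ε : ℕ → Bool) (m : ℕ) :
    ‖(gapPoint ε : ℂ) ^ 2 ^ gapExp m - 1‖ ≤ 1 / 5 * (1 / 2) ^ m := by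
  obtain ⟨n, t, h0, h1, h⟩ := two_pow_mul_gapReal ε m
  have hexp : gapPoint ε ^ 2 ^ gapExp m = Circle.exp (2 * Real.pi * t) := by
    rw [gapPoint, ← Circle.exp_natCast_mul, Circle.exp_eq_exp]
    refine ⟨2 * n + if ε m then 1 else 0, ?_⟩
    push_cast
    split_ifs at h ⊢ <;> linear_combination (2 * Real.pi) * h
  rw [← Circle.coe_pow, hexp]
  refine (norm_exp_sub_one_le _).trans ?_
  rw [abs_of_nonneg (by positivity)]
  rw [pow_add] at h1
  have := Real.pi_lt_d2
  have h2 : (0 : ℝ) < (1 / 2) ^ m := by positivity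
  calc 2 * Real.pi * t ≤ 2 * 3.15 * ((1 / 2) ^ m * (1 / 2) ^ 5) := by gcongr
    _ ≤ _ := by linarith

lemma gapPoint_pow_half (ε : ℕ → Bool) (m : ℕ) :
    ‖(gapPoint ε : ℂ) ^ 2 ^ (gapExp m - 1) - if ε m then -1 else 1‖ < 1 := by
  obtain ⟨n, t, h0, h1, h⟩ := two_pow_mul_gapReal ε m
  have hm : gapExp m = gapExp m - 1 + 1 := by simp [gapExp]
  have hexp : gapPoint ε ^ 2 ^ (gapExp m - 1) =
      (if ε m then Circle.exp Real.pi else 1) * Circle.exp (Real.pi * t) := by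
    have : gapPoint ε ^ 2 ^ (gapExp m - 1) =
        Circle.exp ((if ε m then Real.pi else 0) + Real.pi * t) := by
      rw [gapPoint, ← Circle.exp_natCast_mul, Circle.exp_eq_exp]
      refine ⟨n, ?_⟩
      rw [hm, pow_succ] at h
      push_cast
      split_ifs at h ⊢ <;> linear_combination Real.pi * h
    rw [this, Circle.exp_add]
    split_ifs <;> simp
  have hexp' : (gapPoint ε : ℂ) ^ 2 ^ (gapExp m - 1) - (if ε m then -1 else 1) =
      (if ε m then -1 else 1) * ((Circle.exp (Real.pi * t) : ℂ) - 1) := by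
    rw [← Circle.coe_pow, hexp]
    split_ifs <;> simp [Circle.coe_exp, Complex.exp_pi_mul_I]
    ring
  have hsgn : ‖(if ε m then -1 else 1 : ℂ)‖ = 1 := by split_ifs <;> simp
  rw [hexp', norm_mul, hsgn, one_mul]
  refine (norm_exp_sub_one_le _).trans_lt ?_
  rw [abs_of_nonneg (by positivity)]
  have h2 : (1 / 2 : ℝ) ^ (m + 5) ≤ (1 / 2) ^ 5 :=
    pow_le_pow_of_le_one (by norm_num) (by norm_num) (by omega)
  have := Real.pi_lt_d2
  calc Real.pi * t ≤ 3.15 * (1 / 2) ^ 5 := by gcongr; exact h1.trans h2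
    _ < 1 := by norm_num

lemma injective_gapPoint : Function.Injective gapPoint := by
  have key : ∀ {ε ε' : ℕ → Bool}, gapPoint ε = gapPoint ε' → ∀ m, ε m = true → ε' m = true := by
    intro ε ε' h m hm
    by_contra hm'
    have h1 := gapPoint_pow_half ε m
    have h2 := gapPoint_pow_half ε' m
    rw [if_pos hm, h] at h1
    rw [if_neg hm'] at h2
    have h3 := norm_sub_le ((gapPoint ε' : ℂ) ^ 2 ^ (gapExp m - 1) - -1)
      ((gapPoint ε' : ℂ) ^ 2 ^ (gapExp m - 1) - 1)
    rw [sub_sub_sub_cancel_left] at h3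
    norm_num at h1 h2 h3
    linarith
  intro ε ε' h
  funext m
  exact Bool.eq_iff_iff.2 ⟨key h m, key h.symm m⟩

lemma le_cosMean_gapPoint_div (ε ε' : ℕ → Bool) (m : ℕ) :
    1 - 4 / 15 * (1 / 2) ^ m ≤ cosMean (2 ^ gapExp m) (gapPoint ε / gapPoint ε') := by
  set a := (gapPoint ε : ℂ) ^ 2 ^ gapExp m with ha
  set b := (gapPoint ε' : ℂ) ^ 2 ^ gapExp m with hb
  have hb1 : ‖b‖ = 1 := by simp [hb, Circle.norm_coe]
  have hb0 : b ≠ 0 := norm_ne_zero_iff.1 (by rw [hb1]; norm_num)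
  have h1 : ‖a / b - 1‖ ≤ 2 / 5 * (1 / 2) ^ m := by
    have h : ‖a / b - 1‖ = ‖(a - 1) - (b - 1)‖ := by
      rw [div_sub_one hb0, norm_div, hb1, div_one, sub_sub_sub_cancel_right]
    rw [h]
    refine (norm_sub_le _ _).trans ?_
    linarith [norm_gapPoint_pow_sub_one_le ε m, norm_gapPoint_pow_sub_one_le ε' m]
  have h2 := (abs_le.1 (Complex.abs_re_le_norm (a / b - 1))).1
  rw [Complex.sub_re, Complex.one_re] at h2
  have h3 : cosMean (2 ^ gapExp m) (gapPoint ε / gapPoint ε') = (1 + 2 * (a / b).re) / 3 := by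
    rw [cosMean, Circle.coe_div, div_pow]
  linarith

lemma quarter_le_prod_cosMean (ε ε' : ℕ → Bool) (k : ℕ) :
    1 / 4 ≤ ∏ m ∈ Finset.range k, cosMean (2 ^ gapExp m) (gapPoint ε / gapPoint ε') := by
  set g := fun m => cosMean (2 ^ gapExp m) (gapPoint ε / gapPoint ε') with hg
  have key : ∀ k, 1 - 8 / 15 * (1 - (1 / 2) ^ k) ≤ ∏ m ∈ Finset.range k, g m ∧
      ∏ m ∈ Finset.range k, g m ≤ 1 := by
    intro k
    induction k with
    | zero => simp
    | succ k ih =>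
      have h1 := le_cosMean_gapPoint_div ε ε' k
      have h2 := cosMean_le_one (2 ^ gapExp k) (gapPoint ε / gapPoint ε')
      change _ ≤ g k at h1
      change g k ≤ 1 at h2
      have h3 : (0 : ℝ) < (1 / 2) ^ k := by positivity
      have h4 : 0 ≤ ∏ m ∈ Finset.range k, g m := by linarith [ih.1]
      rw [Finset.prod_range_succ]
      refine ⟨?_, mul_le_one₀ ih.2 ?_ h2⟩
      · rw [pow_succ]
        nlinarith [ih.1, ih.2]
      · have : (1 / 2 : ℝ) ^ k ≤ 1 := pow_le_one₀ (by norm_num) (by norm_num)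
        linarith
  have := (key k).1
  have h3 : (0 : ℝ) < (1 / 2) ^ k := by positivity
  linarith

/-- The squared Fourier coefficients of `μ` are the Fourier coefficients of the law of the quotient
of two independent points with law `μ`. -/
lemma integral_div_pow_prod (μ : Measure Circle) [IsProbabilityMeasure μ] (n : ℕ) :
    ∫ x : Circle × Circle, ((x.1 / x.2 : Circle) : ℂ) ^ n ∂(μ.prod μ) =
      ((‖∫ z : Circle, (z : ℂ) ^ n ∂μ‖ ^ 2 : ℝ) : ℂ) := by
  have h : ∀ x : Circle × Circle, ((x.1 / x.2 : Circle) : ℂ) ^ n =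
      (x.1 : ℂ) ^ n * (starRingEnd ℂ) ((x.2 : ℂ) ^ n) := by
    intro x
    rw [div_eq_mul_inv, Circle.coe_mul, Circle.coe_inv_eq_conj, mul_pow, map_pow]
  simp_rw [h]
  refine (integral_prod_mul (fun z : Circle => (z : ℂ) ^ n)
    fun z : Circle => (starRingEnd ℂ) ((z : ℂ) ^ n)).trans ?_
  rw [integral_conj, Complex.mul_conj, Complex.normSq_eq_norm_sq]

/-- Averages of squared Fourier coefficients along a good sequence. -/
lemma tendsto_average_norm_sq_fourier (μ : Measure Circle) [IsProbabilityMeasure μ] {s : ℕ → ℕ}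
    {c : Circle → ℝ}
    (hc : ∀ z : Circle, Filter.Tendsto
      (fun N : ℕ => (N : ℂ)⁻¹ * ∑ n ∈ Finset.range N, (z : ℂ) ^ s n) Filter.atTop (nhds (c z))) :
    Integrable (fun x : Circle × Circle => c (x.1 / x.2)) (μ.prod μ) ∧
      Filter.Tendsto (fun N : ℕ => (N : ℝ)⁻¹ * ∑ n ∈ Finset.range N,
        ‖∫ z : Circle, (z : ℂ) ^ s n ∂μ‖ ^ 2) Filter.atTop
        (nhds (∫ x : Circle × Circle, c (x.1 / x.2) ∂(μ.prod μ))) := by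
  set F : ℕ → Circle × Circle → ℂ := fun N x =>
    (N : ℂ)⁻¹ * ∑ n ∈ Finset.range N, ((x.1 / x.2 : Circle) : ℂ) ^ s n with hF
  have hpow : ∀ n, Continuous fun x : Circle × Circle => ((x.1 / x.2 : Circle) : ℂ) ^ n := by
    intro n
    have h : Continuous fun x : Circle × Circle => x.1 / x.2 := continuous_fst.div' continuous_snd
    exact (continuous_subtype_val.comp h).pow n
  have hcont : ∀ N, Continuous (F N) := fun N =>
    continuous_const.mul (continuous_finsetSum _ fun n _ => hpow _)
  have hbound : ∀ N x, ‖F N x‖ ≤ 1 := by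
    intro N x
    have : ‖∑ n ∈ Finset.range N, ((x.1 / x.2 : Circle) : ℂ) ^ s n‖ ≤ N := by
      refine (norm_sum_le _ _).trans (le_of_eq ?_)
      simp [-Circle.coe_div, Circle.norm_coe]
    rw [norm_mul, norm_inv, Complex.norm_natCast, inv_mul_eq_div]
    exact div_le_one_of_le₀ this (Nat.cast_nonneg N)
  have hre : ∀ x : Circle × Circle,
      Filter.Tendsto (fun N => (F N x).re) Filter.atTop (nhds (c (x.1 / x.2))) := fun x =>
    (Complex.continuous_re.tendsto _).comp (hc (x.1 / x.2))
  have hmeas : ∀ N, AEStronglyMeasurable (fun x => (F N x).re) (μ.prod μ) := fun N =>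
    (Complex.continuous_re.comp (hcont N)).aestronglyMeasurable
  have hre_bound : ∀ N x, ‖(F N x).re‖ ≤ 1 := fun N x =>
    (Complex.abs_re_le_norm _).trans (hbound N x)
  refine ⟨?_, ?_⟩
  · refine Integrable.of_bound
      (aestronglyMeasurable_of_tendsto_ae Filter.atTop hmeas (Filter.Eventually.of_forall hre)) 1
      (Filter.Eventually.of_forall fun x => ?_)
    exact le_of_tendsto' (hre x).norm fun N => hre_bound N x
  · have hlim := tendsto_integral_of_dominated_convergence (μ := μ.prod μ) (fun _ => (1 : ℝ)) hmeas
      (integrable_const 1) (fun N => Filter.Eventually.of_forall (hre_bound N))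
      (Filter.Eventually.of_forall hre)
    refine hlim.congr fun N => ?_
    have hint : Integrable (F N) (μ.prod μ) :=
      Integrable.of_bound (hcont N).aestronglyMeasurable 1 (Filter.Eventually.of_forall (hbound N))
    have hint' : ∀ n, Integrable (fun x : Circle × Circle => ((x.1 / x.2 : Circle) : ℂ) ^ s n)
        (μ.prod μ) := fun n =>
      Integrable.of_bound (hpow _).aestronglyMeasurable 1
        (Filter.Eventually.of_forall fun x => by simp [-Circle.coe_div, Circle.norm_coe])
    have hre_int := integral_re hint
    simp only [RCLike.re_to_complex] at hre_int
    rw [hre_int]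
    simp only [hF]
    rw [integral_const_mul, integral_finsetSum _ fun n _ => hint' n,
      Finset.sum_congr rfl fun n _ => integral_div_pow_prod μ (s n)]
    rw [← Complex.ofReal_sum, ← Complex.ofReal_natCast, ← Complex.ofReal_inv,
      ← Complex.ofReal_mul, Complex.ofReal_re]

lemma exists_atomless_measure_on_range_gapPoint :
    ∃ μ : Measure Circle, IsProbabilityMeasure μ ∧ (∀ z : Circle, μ {z} = 0) ∧
      ∀ᵐ z ∂μ, z ∈ Set.range gapPoint := by
  obtain ⟨e, he, hinj⟩ :=
    MeasurableSpace.measurable_injection_nat_bool_of_countablySeparated unitInterval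
  have hf : Measurable (gapPoint ∘ e) := continuous_gapPoint.measurable.comp he
  refine ⟨(volume : Measure unitInterval).map (gapPoint ∘ e),
    Measure.isProbabilityMeasure_map hf.aemeasurable, fun z => ?_, ?_⟩
  · rw [Measure.map_apply hf (measurableSet_singleton z)]
    exact (Set.subsingleton_singleton.preimage (injective_gapPoint.comp hinj)).measure_zero _
  · refine (ae_map_iff (p := fun z => z ∈ Set.range gapPoint) hf.aemeasurable
      (isCompact_range continuous_gapPoint).isClosed.measurableSet).2 ?_
    exact Filter.Eventually.of_forall fun x => ⟨e x, rfl⟩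

/-- There exist a good sequence `(s_n)` and a continuous (atomless)
probability measure `μ` on the circle such that `(1/N) ∑_{n=1}^N |μ̂(s_n)|²` converges to
a strictly positive number. -/
theorem stmt_15 :
    ∃ s : ℕ → ℕ, StrictMono s ∧ 0 < s 0 ∧
      (∀ z : Circle, ∃ c : ℂ,
        Filter.Tendsto (fun N : ℕ => (N : ℂ)⁻¹ * ∑ n ∈ Finset.range N, (z : ℂ) ^ (s n))
          Filter.atTop (nhds c)) ∧
      ∃ μ : Measure Circle, IsProbabilityMeasure μ ∧ (∀ z : Circle, μ {z} = 0) ∧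
        ∃ l : ℝ, 0 < l ∧
          Filter.Tendsto (fun N : ℕ => (N : ℝ)⁻¹ * ∑ n ∈ Finset.range N,
              ‖∫ z : Circle, (z : ℂ) ^ (s n) ∂μ‖ ^ 2)
            Filter.atTop (nhds l) := by
  have hq := three_mul_sum_two_pow_gapExp_lt
  choose c hprod hc using tendsto_average_blockSeq hq
  obtain ⟨μ, hμ, hatom, hrange⟩ := exists_atomless_measure_on_range_gapPoint
  obtain ⟨hint, hlim⟩ := tendsto_average_norm_sq_fourier μ hc
  refine ⟨blockSeq fun j => 2 ^ gapExp j, strictMono_blockSeq hq, blockSeq_pos hq 0,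
    fun z => ⟨_, hc z⟩, μ, hμ, hatom, _, ?_, hlim⟩
  have hle : ∀ᵐ x ∂(μ.prod μ), 1 / 4 ≤ c (x.1 / x.2) := by
    filter_upwards [Measure.quasiMeasurePreserving_fst.ae hrange,
      Measure.quasiMeasurePreserving_snd.ae hrange] with x ⟨ε, hε⟩ ⟨ε', hε'⟩
    rw [← hε, ← hε']
    exact ge_of_tendsto' (hprod _) (quarter_le_prod_cosMean ε ε')
  have hmono := integral_mono_ae (integrable_const (1 / 4 : ℝ)) hint hle
  rw [integral_const, probReal_univ, one_smul] at hmono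
  linarith
end

section
/- Suppose (m_j)_{j≥1} additionally satisfies: m_j divides m_{j+1} for every j and m_{j+1}/m_j → ∞. Then there exists a continuous (atomless) probability measure μ on the unit circle, concentrated on the spectrum Λ_S, such that (1/N) Σ_{n=1}^{N} μ̂(s_n) converges as N → ∞ to a strictly positive real number, and consequently (1/N) Σ_{n=1}^{N} |μ̂(s_n)|² converges to a strictly positive number. -/
open MeasureTheory

/-- The set of integers `m_k + ∑_{j=1}^{k-1} ω_j m_j`, `k ≥ 1`, `ω ∈ {-1,0,1}^{k-1}`. -/
def goodSet (m : ℕ → ℕ) : Set ℕ :=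
  {x | ∃ k, 1 ≤ k ∧ ∃ ω : ℕ → ℤ, (∀ j, ω j ∈ ({-1, 0, 1} : Set ℤ)) ∧
    (x : ℤ) = (m k : ℤ) + ∑ j ∈ Finset.Icc 1 (k - 1), ω j * (m j : ℤ)}

/-- The points of the circle at which every `z ^ x`, `x ∈ goodSet m`, is within `1/2` of `1`. -/
def nearOneSet (m : ℕ → ℕ) : Set Circle :=
  {z | ∀ x ∈ goodSet m, ‖(z : ℂ) ^ x - 1‖ ≤ 1 / 2}

lemma norm_circle_pow (z : Circle) (k : ℕ) : ‖(z : ℂ) ^ k‖ = 1 := by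
  rw [norm_pow, Circle.norm_coe, one_pow]

lemma coe_inv_pow (z : Circle) (k : ℕ) :
    ((z⁻¹ : Circle) : ℂ) ^ k = starRingEnd ℂ ((z : ℂ) ^ k) := by
  rw [Circle.coe_inv_eq_conj, map_pow]

lemma measurable_circle_coe : Measurable fun z : Circle => (z : ℂ) := by
  have h : Continuous fun z : Circle => (z : ℂ) := by fun_prop
  exact h.measurable

lemma isClosed_nearOneSet (m : ℕ → ℕ) : IsClosed (nearOneSet m) := by
  have : nearOneSet m = ⋂ x ∈ goodSet m, {z : Circle | ‖(z : ℂ) ^ x - 1‖ ≤ 1 / 2} := by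
    ext z; simp [nearOneSet]
  rw [this]
  exact isClosed_biInter fun x _ => isClosed_le (by fun_prop) continuous_const

lemma inv_mem_nearOneSet {m : ℕ → ℕ} {z : Circle} (hz : z ∈ nearOneSet m) :
    z⁻¹ ∈ nearOneSet m := by
  intro x hx
  have h := hz x hx
  rw [← RCLike.norm_conj] at h
  rwa [coe_inv_pow, ← map_one (starRingEnd ℂ), ← map_sub]

lemma half_le_re_of_mem_nearOneSet {m : ℕ → ℕ} {z : Circle} (hz : z ∈ nearOneSet m)
    {x : ℕ} (hx : x ∈ goodSet m) : 1 / 2 ≤ ((z : ℂ) ^ x).re := by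
  have h := (Complex.abs_re_le_norm _).trans (hz x hx)
  rw [Complex.sub_re, Complex.one_re, abs_le] at h
  linarith [h.1]

lemma norm_circleExp_sub_one_le (t : ℝ) :
    ‖(Circle.exp (2 * Real.pi * t) : ℂ) - 1‖ ≤ 2 * Real.pi * ‖(t : UnitAddCircle)‖ := by
  have h : Circle.exp (2 * Real.pi * t) = Circle.exp (2 * Real.pi * (t - round t)) :=
    Circle.exp_eq_exp.2 ⟨round t, by ring⟩
  have hb := Real.norm_exp_I_mul_ofReal_sub_one_le (x := 2 * Real.pi * (t - round t))
  rw [h, Circle.coe_exp, mul_comm _ Complex.I, UnitAddCircle.norm_eq]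
  refine hb.trans_eq ?_
  rw [Real.norm_eq_abs, abs_mul, abs_of_pos (by positivity : 0 < 2 * Real.pi)]

lemma two_mul_sum_le_three_mul {m : ℕ → ℕ} (hratio : ∀ j, 1 ≤ j → 3 * m j ≤ m (j + 1)) (k : ℕ) :
    2 * ∑ j ∈ Finset.Icc 1 k, m j ≤ 3 * m k := by
  induction k with
  | zero => simp
  | succ k ih =>
    rw [Finset.sum_Icc_succ_top (by omega)]
    rcases Nat.eq_zero_or_pos k with rfl | hk
    · simp; omega
    · have := hratio k hk
      omega

lemma dvd_of_le_of_dvd_succ {m : ℕ → ℕ} (hdvd : ∀ j, 1 ≤ j → m j ∣ m (j + 1)) {a b : ℕ}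
    (ha : 1 ≤ a) (hab : a ≤ b) : m a ∣ m b := by
  induction b, hab using Nat.le_induction with
  | base => exact dvd_rfl
  | succ b hb ih => exact ih.trans (hdvd b (ha.trans hb))

lemma norm_goodSet_div_le {m : ℕ → ℕ} (hpos : ∀ j, 1 ≤ j → 0 < m j)
    (hratio : ∀ j, 1 ≤ j → 3 * m j ≤ m (j + 1)) (hdvd : ∀ j, 1 ≤ j → m j ∣ m (j + 1))
    {x : ℕ} (hx : x ∈ goodSet m) (p : ℕ) :
    ‖(((x : ℝ) / m (p + 1) : ℝ) : UnitAddCircle)‖ ≤ 2 * m p / m (p + 1) := by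
  obtain ⟨k, hk, ω, hω, hx⟩ := hx
  have hM : (0 : ℝ) < m (p + 1) := by exact_mod_cast hpos _ (by omega)
  have hω1 : ∀ j, |(ω j : ℝ)| ≤ 1 := by
    intro j
    rcases hω j with h | h | h <;> simp_all
  set b : ℕ → ℝ := fun j => if j ∈ Finset.Icc 1 p then (m j : ℝ) / m (p + 1) else 0 with hb
  have hb0 : ∀ j, 0 ≤ b j := fun j => by simp only [hb]; split_ifs <;> positivity
  have key : ∀ j, 1 ≤ j → ∀ w : ℤ, |(w : ℝ)| ≤ 1 →
      ‖((w * m j / m (p + 1) : ℝ) : UnitAddCircle)‖ ≤ b j := by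
    intro j hj w hw
    by_cases hjp : j ≤ p
    · have : b j = (m j : ℝ) / m (p + 1) := by simp [hb, hj, hjp]
      rw [this, UnitAddCircle.norm_eq]
      refine (round_le _ 0).trans ?_
      rw [Int.cast_zero, sub_zero, mul_div_assoc, abs_mul,
        abs_of_nonneg (by positivity : 0 ≤ (m j : ℝ) / m (p + 1))]
      exact mul_le_of_le_one_left (by positivity) hw
    · obtain ⟨q, hq⟩ := dvd_of_le_of_dvd_succ hdvd (by omega : 1 ≤ p + 1) (by omega : p + 1 ≤ j)
      have : (w * m j / m (p + 1) : ℝ) = ((w * q : ℤ) : ℝ) := by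
        rw [hq]; push_cast; field_simp
      rw [this, UnitAddCircle.norm_eq, round_intCast, sub_self, abs_zero]
      exact hb0 j
  have hxr : ((x : ℝ) / m (p + 1) : ℝ) =
      ((1 : ℤ) : ℝ) * m k / m (p + 1)
        + ∑ j ∈ Finset.Icc 1 (k - 1), (ω j : ℝ) * m j / m (p + 1) := by
    have : (x : ℝ) = m k + ∑ j ∈ Finset.Icc 1 (k - 1), (ω j : ℝ) * m j := by exact_mod_cast hx
    rw [this, add_div, Finset.sum_div]; simp
  have hsum : ∑ j ∈ Finset.Icc 1 k, b j ≤ ∑ j ∈ Finset.Icc 1 p, (m j : ℝ) / m (p + 1) := by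
    simp only [hb, ← Finset.sum_filter]
    refine Finset.sum_le_sum_of_subset_of_nonneg ?_ fun _ _ _ => by positivity
    intro j; simp only [Finset.mem_filter]; exact fun h => h.2
  have hsum2 : ∑ j ∈ Finset.Icc 1 p, (m j : ℝ) / m (p + 1) ≤ 2 * m p / m (p + 1) := by
    rw [← Finset.sum_div]
    gcongr
    have : (2 : ℝ) * ∑ j ∈ Finset.Icc 1 p, (m j : ℝ) ≤ 3 * m p := by
      exact_mod_cast two_mul_sum_le_three_mul hratio p
    have : (0 : ℝ) ≤ m p := by positivity
    linarith
  refine le_trans ?_ (hsum.trans hsum2)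
  obtain ⟨k, rfl⟩ : ∃ k', k = k' + 1 := ⟨k - 1, by omega⟩
  rw [Finset.sum_Icc_succ_top (by omega), hxr, AddCircle.coe_add, add_comm, Nat.add_sub_cancel]
  refine (norm_add_le _ _).trans (add_le_add ?_ (key _ hk 1 (by simp)))
  rw [show ((∑ j ∈ Finset.Icc 1 k, (ω j : ℝ) * m j / m (p + 1) : ℝ) : UnitAddCircle) =
    ∑ j ∈ Finset.Icc 1 k, (((ω j : ℝ) * m j / m (p + 1) : ℝ) : UnitAddCircle) from
      map_sum (QuotientAddGroup.mk' (AddSubgroup.zmultiples (1 : ℝ))) _ _]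
  refine norm_sum_le_of_le _ fun j hj => key j (Finset.mem_Icc.1 hj).1 _ (hω1 j)

lemma eq_of_hasSum_indicator {a : ℕ → ℝ} (hapos : ∀ i, 0 < a i)
    (ha : ∀ i, 3 * a (i + 1) ≤ a i) {ε ε' : ℕ → Bool} {t : ℝ}
    (h : HasSum (fun i => if ε i then a i else 0) t)
    (h' : HasSum (fun i => if ε' i then a i else 0) t) : ε = ε' := by
  by_contra hne
  have hex : ∃ i, ε i ≠ ε' i := Function.ne_iff.1 hne
  classical
  set n := Nat.find hex with hn
  have hlt : ∀ i < n, ε i = ε' i := fun i hi => not_not.1 (Nat.find_min hex hi)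
  have hnn : ε n ≠ ε' n := Nat.find_spec hex
  set d : ℕ → ℝ := fun i => (if ε i then a i else 0) - (if ε' i then a i else 0) with hd
  have hs : HasSum d 0 := by simpa using h.sub h'
  have hs' := (hasSum_nat_add_iff' (n + 1)).2 hs
  have hsum : ∑ i ∈ Finset.range (n + 1), d i = d n := by
    rw [Finset.sum_range_succ, Finset.sum_eq_zero, zero_add]
    intro i hi
    simp [hd, hlt i (Finset.mem_range.1 hi)]
  have hdle : ∀ i, |d i| ≤ a i := fun i => by
    have := hapos i
    simp only [hd]
    split_ifs <;> simp [abs_of_pos, this, this.le]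
  have hdn : |d n| = a n := by
    have := hapos n
    simp only [hd]
    have hna : |a n| = a n := abs_of_pos this
    cases h1 : ε n <;> cases h2 : ε' n <;> rw [h1, h2] at hnn <;> simp [hna] at hnn ⊢
  have hgeom : ∀ i, a (i + (n + 1)) ≤ a n / 3 * (1 / 3) ^ i := by
    intro i
    induction i with
    | zero => have := ha n; simp; linarith
    | succ i ih =>
      have := ha (i + (n + 1))
      rw [show i + 1 + (n + 1) = i + (n + 1) + 1 by ring, pow_succ]
      linarith
  have hg : HasSum (fun i : ℕ => a n / 3 * (1 / 3 : ℝ) ^ i) (a n / 3 * (1 - 1 / 3)⁻¹) :=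
    (hasSum_geometric_of_lt_one (by norm_num) (by norm_num)).mul_left _
  have hle := hs'.norm_le_of_bounded hg fun i => (hdle _).trans (hgeom i)
  rw [hsum, zero_sub, norm_neg, Real.norm_eq_abs, hdn] at hle
  have := hapos n
  norm_num at hle
  linarith

lemma not_countable_nat_bool : ¬ Countable (ℕ → Bool) := by
  rw [← Cardinal.mk_le_aleph0_iff, not_le]
  simpa using Cardinal.cantor Cardinal.aleph0

lemma not_countable_nearOneSet {m : ℕ → ℕ} (hpos : ∀ j, 1 ≤ j → 0 < m j)
    (hratio : ∀ j, 1 ≤ j → 3 * m j ≤ m (j + 1)) (hdvd : ∀ j, 1 ≤ j → m j ∣ m (j + 1))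
    (hlim : Filter.Tendsto (fun j : ℕ => (m (j + 1) : ℝ) / (m j : ℝ))
      Filter.atTop Filter.atTop) : ¬ Countable (nearOneSet m) := by
  obtain ⟨J, hJ, hJP⟩ := Filter.extraction_forall_of_eventually
    (P := fun i k => 1 ≤ k ∧ 80 * 2 ^ i ≤ (m (k + 1) : ℝ) / m k)
    fun i => (Filter.eventually_ge_atTop 1).and (hlim.eventually_ge_atTop _)
  have hM : ∀ i, (0 : ℝ) < m (J i + 1) := fun i => by exact_mod_cast hpos _ (by omega)
  have hm1 : ∀ i, (1 : ℝ) ≤ m (J i) := fun i => by exact_mod_cast hpos _ (hJP i).1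
  have hδ : ∀ i, 2 * m (J i) / m (J i + 1) ≤ (1 / 20 : ℝ) / 2 / 2 ^ i := by
    intro i
    have h := (hJP i).2
    rw [le_div_iff₀ (by linarith [hm1 i])] at h
    rw [div_div, div_div, div_le_div_iff₀ (hM i) (by positivity)]
    linarith
  have hgeo : HasSum (fun i : ℕ => (1 / 20 : ℝ) / 2 / 2 ^ i) (1 / 20) := hasSum_geometric_two' _
  set a : ℕ → ℝ := fun i => 1 / m (J i + 1) with ha
  have hapos : ∀ i, 0 < a i := fun i => by have := hM i; simp only [ha]; positivity
  have hale : ∀ i, a i ≤ (1 / 20 : ℝ) / 2 / 2 ^ i := fun i => by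
    refine le_trans ?_ (hδ i)
    have := hM i
    simp only [ha]
    gcongr
    linarith [hm1 i]
  have ha3 : ∀ i, 3 * a (i + 1) ≤ a i := by
    intro i
    have h1 : m (J i + 1) ≤ m (J (i + 1)) := Nat.le_of_dvd (hpos _ (hJP _).1)
      (dvd_of_le_of_dvd_succ hdvd (by omega) (hJ (Nat.lt_succ_self i)))
    have h2 := hratio _ (hJP (i + 1)).1
    have h3 : (3 : ℝ) * m (J i + 1) ≤ m (J (i + 1) + 1) := by
      exact_mod_cast (by omega : 3 * m (J i + 1) ≤ m (J (i + 1) + 1))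
    simp only [ha]
    rw [mul_one_div, div_le_div_iff₀ (hM _) (hM _)]
    linarith
  have hbd : ∀ (ε : ℕ → Bool) i, ‖if ε i then a i else 0‖ ≤ (1 / 20 : ℝ) / 2 / 2 ^ i := by
    intro ε i
    split_ifs
    · rw [Real.norm_of_nonneg (hapos i).le]; exact hale i
    · simp; positivity
  have hsum : ∀ ε : ℕ → Bool, Summable fun i => if ε i then a i else 0 := fun ε =>
    Summable.of_norm_bounded hgeo.summable (hbd ε)
  set θ : (ℕ → Bool) → ℝ := fun ε => ∑' i, if ε i then a i else 0 with hθ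
  have hθs : ∀ ε, HasSum (fun i => if ε i then a i else 0) (θ ε) := fun ε => (hsum ε).hasSum
  have hθb : ∀ ε, |θ ε| ≤ 1 / 20 := fun ε => (hθs ε).norm_le_of_bounded hgeo (hbd ε)
  have hmem : ∀ ε, Circle.exp (2 * Real.pi * θ ε) ∈ nearOneSet m := by
    intro ε x hx
    have hpow : (Circle.exp (2 * Real.pi * θ ε) : ℂ) ^ x =
        Circle.exp (2 * Real.pi * (x * θ ε)) := by
      rw [← Circle.coe_pow, ← Circle.exp_nsmul]
      congr 2
      simp; ring
    rw [hpow]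
    refine (norm_circleExp_sub_one_le _).trans ?_
    have hsx := ((hθs ε).mul_left (x : ℝ)).map
      (QuotientAddGroup.mk' (AddSubgroup.zmultiples (1 : ℝ))) (AddCircle.continuous_mk' 1)
    have hle := hsx.norm_le_of_bounded hgeo fun i => by
      by_cases hi : ε i
      · have := (norm_goodSet_div_le hpos hratio hdvd hx (J i)).trans (hδ i)
        simpa [hi, ha, div_eq_mul_inv] using this
      · simp [hi]; positivity
    have hle' : ‖((x * θ ε : ℝ) : UnitAddCircle)‖ ≤ 1 / 20 := hle
    have := Real.pi_lt_four
    have := Real.pi_pos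
    nlinarith
  intro hc
  refine not_countable_nat_bool (Function.Injective.countable (β := nearOneSet m)
    (f := fun ε => ⟨_, hmem ε⟩) fun ε ε' h => ?_)
  obtain ⟨k, hk⟩ := Circle.exp_eq_exp.1 (Subtype.ext_iff.1 h)
  have hk' : θ ε = θ ε' + k := by
    have := Real.pi_pos
    refine mul_left_cancel₀ (by positivity : 2 * Real.pi ≠ 0) ?_
    linarith
  have hk0 : k = 0 := by
    have h1 := abs_le.1 (hθb ε)
    have h2 := abs_le.1 (hθb ε')
    have h3 : (k : ℝ) < 1 := by linarith [h1.2, h2.1]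
    have h4 : (-1 : ℝ) < k := by linarith [h1.1, h2.2]
    have h3' : k < 1 := by exact_mod_cast h3
    have h4' : -1 < k := by exact_mod_cast h4
    omega
  have h1 := hθs ε
  rw [hk', hk0, Int.cast_zero, add_zero] at h1
  exact eq_of_hasSum_indicator hapos ha3 h1 (hθs ε')

/-- An uncountable measurable set of the circle that is stable under inversion carries an atomless
inversion-invariant probability measure. -/
lemma exists_isProbabilityMeasure_map_inv {G : Set Circle} (hG : MeasurableSet G)
    (hGc : ¬ Countable G) (hinv : ∀ z ∈ G, z⁻¹ ∈ G) :
    ∃ μ : Measure Circle, IsProbabilityMeasure μ ∧ (∀ z : Circle, μ {z} = 0) ∧ μ Gᶜ = 0 ∧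
      μ.map (fun z => z⁻¹) = μ := by
  have hstd : StandardBorelSpace G := hG.standardBorel
  let e : ℝ ≃ᵐ G := PolishSpace.measurableEquivOfNotCountable
    (fun h => Cardinal.not_countable_real (Set.countable_univ_iff.2 h)) hGc
  set f : ℝ → Circle := fun t => (e t : Circle) with hf
  have hfm : Measurable f := measurable_subtype_coe.comp e.measurable
  have hfi : Function.Injective f := Subtype.val_injective.comp e.injective
  have him : Measurable fun z : Circle => z⁻¹ := continuous_inv.measurable
  set ρ : Measure ℝ := volume.restrict (Set.Icc 0 1) with hρ
  have hρp : IsProbabilityMeasure ρ := ⟨by simp [hρ]⟩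
  set ν := ρ.map f with hν
  have hνp : IsProbabilityMeasure ν := Measure.isProbabilityMeasure_map hfm.aemeasurable
  have hνp' : IsProbabilityMeasure (ν.map fun z => z⁻¹) :=
    Measure.isProbabilityMeasure_map him.aemeasurable
  have hν0 : ∀ z, ν {z} = 0 := fun z => by
    rw [hν, Measure.map_apply hfm (measurableSet_singleton z)]
    exact ((Set.subsingleton_singleton).preimage hfi).measure_zero _
  have hνG : ν Gᶜ = 0 := by
    rw [hν, Measure.map_apply hfm hG.compl]
    convert measure_empty (μ := ρ)
    ext t
    simp [hf]
  have hval : ∀ s, MeasurableSet s → ((2 : ENNReal)⁻¹ • (ν + ν.map fun z => z⁻¹)) s =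
      2⁻¹ * (ν s + ν ((fun z => z⁻¹) ⁻¹' s)) := fun s hs => by
    simp [Measure.map_apply him hs, mul_add]
  refine ⟨(2 : ENNReal)⁻¹ • (ν + ν.map fun z => z⁻¹), ⟨?_⟩, fun z => ?_, ?_, ?_⟩
  · rw [hval _ MeasurableSet.univ]
    simp only [Set.preimage_univ, measure_univ, one_add_one_eq_two]
    exact ENNReal.inv_mul_cancel (by simp) (by simp)
  · rw [hval _ (measurableSet_singleton z), hν0]
    have : (fun z : Circle => z⁻¹) ⁻¹' {z} = {z⁻¹} := by
      ext w; simp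
    simp [this, hν0]
  · rw [hval _ hG.compl, hνG]
    have : ν ((fun z : Circle => z⁻¹) ⁻¹' Gᶜ) = 0 := by
      refine measure_mono_null (fun z hz hzG => hz (hinv z hzG)) hνG
    rw [this, add_zero, mul_zero]
  · rw [Measure.map_smul, Measure.map_add _ _ him, Measure.map_map him him, add_comm]
    simp

lemma le_re_average {r : ℝ} {u : ℕ → ℂ} (hu : ∀ n, r ≤ (u n).re) {N : ℕ} (hN : 1 ≤ N) :
    r ≤ ((N : ℂ)⁻¹ * ∑ n ∈ Finset.range N, u n).re := by
  have hN' : (0 : ℝ) < N := by exact_mod_cast hN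
  rw [show ((N : ℂ)⁻¹) = (((N : ℝ)⁻¹ : ℝ) : ℂ) by push_cast; rfl, Complex.re_ofReal_mul,
    Complex.re_sum, le_inv_mul_iff₀ hN']
  simpa using Finset.card_nsmul_le_sum (Finset.range N) _ r fun n _ => hu n

lemma le_re_of_tendsto_average {r : ℝ} {u : ℕ → ℂ} (hu : ∀ n, r ≤ (u n).re) {L : ℂ}
    (hL : Filter.Tendsto (fun N : ℕ => (N : ℂ)⁻¹ * ∑ n ∈ Finset.range N, u n)
      Filter.atTop (nhds L)) : r ≤ L.re :=
  ge_of_tendsto ((Complex.continuous_re.tendsto L).comp hL)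
    ((Filter.eventually_ge_atTop 1).mono fun _ => le_re_average hu)

lemma norm_average_le_one {u : ℕ → ℂ} (hu : ∀ n, ‖u n‖ ≤ 1) (N : ℕ) :
    ‖(N : ℂ)⁻¹ * ∑ n ∈ Finset.range N, u n‖ ≤ 1 := by
  rw [norm_mul, norm_inv, Complex.norm_natCast]
  rcases Nat.eq_zero_or_pos N with rfl | hN
  · simp
  · have hN' : (0 : ℝ) < N := by exact_mod_cast hN
    rw [inv_mul_le_iff₀ hN', mul_one]
    simpa using norm_sum_le_of_le (Finset.range N) fun n _ => hu n

/-- Averages of integrals of powers of a circle-valued map converge whenever the averages of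
powers converge pointwise. -/
lemma tendsto_average_integral_pow {X : Type*} [MeasurableSpace X] (μ : Measure X)
    [IsProbabilityMeasure μ] {g : X → Circle} (hg : Measurable g) {s : ℕ → ℕ} {c : Circle → ℂ}
    (hc : ∀ z : Circle,
      Filter.Tendsto (fun N : ℕ => (N : ℂ)⁻¹ * ∑ n ∈ Finset.range N, (z : ℂ) ^ (s n))
        Filter.atTop (nhds (c z))) :
    Filter.Tendsto (fun N : ℕ => (N : ℂ)⁻¹ * ∑ n ∈ Finset.range N, ∫ x, (g x : ℂ) ^ (s n) ∂μ)
      Filter.atTop (nhds (∫ x, c (g x) ∂μ)) := by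
  have hgm : Measurable fun x => (g x : ℂ) := measurable_circle_coe.comp hg
  have hint : ∀ n, Integrable (fun x => (g x : ℂ) ^ (s n)) μ := fun n =>
    Integrable.of_bound (hgm.pow_const _).aestronglyMeasurable 1
      (Filter.Eventually.of_forall fun x => (norm_circle_pow _ _).le)
  have hrw : ∀ N : ℕ, (N : ℂ)⁻¹ * ∑ n ∈ Finset.range N, ∫ x, (g x : ℂ) ^ (s n) ∂μ =
      ∫ x, (N : ℂ)⁻¹ * ∑ n ∈ Finset.range N, (g x : ℂ) ^ (s n) ∂μ := fun N => by
    rw [integral_const_mul, integral_finsetSum _ fun n _ => hint n]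
  simp only [hrw]
  refine tendsto_integral_of_dominated_convergence (fun _ => 1) (fun N => ?_)
    (integrable_const 1) (fun N => Filter.Eventually.of_forall fun x => ?_)
    (Filter.Eventually.of_forall fun x => hc (g x))
  · exact ((integrable_finsetSum _ fun n _ => hint n).const_mul _).aestronglyMeasurable
  · exact norm_average_le_one (fun n => (norm_circle_pow _ _).le) N

/-- If moreover `m_j ∣ m_{j+1}` and `m_{j+1}/m_j → ∞`, there is a
continuous probability measure `μ` concentrated on the spectrum `Λ_S` such that
`(1/N) ∑ μ̂(s_n)` converges to a strictly positive real number, and consequently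
`(1/N) ∑ |μ̂(s_n)|²` converges to a strictly positive number. -/
theorem stmt_16 (m : ℕ → ℕ) (hpos : ∀ j, 1 ≤ j → 0 < m j)
    (hmono : ∀ j, 1 ≤ j → m j < m (j + 1))
    (hratio : ∀ j, 1 ≤ j → 3 * m j ≤ m (j + 1))
    (hdvd : ∀ j, 1 ≤ j → m j ∣ m (j + 1))
    (hlim : Filter.Tendsto (fun j : ℕ => (m (j + 1) : ℝ) / (m j : ℝ))
      Filter.atTop Filter.atTop)
    (s : ℕ → ℕ) (hs : StrictMono s) (hrange : Set.range s = goodSet m)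
    (c : Circle → ℂ)
    (hc : ∀ z : Circle,
      Filter.Tendsto (fun N : ℕ => (N : ℂ)⁻¹ * ∑ n ∈ Finset.range N, (z : ℂ) ^ (s n))
        Filter.atTop (nhds (c z))) :
    ∃ μ : Measure Circle, IsProbabilityMeasure μ ∧ (∀ z : Circle, μ {z} = 0) ∧
      μ {z : Circle | c z = 0} = 0 ∧
      (∃ l : ℝ, 0 < l ∧
        Filter.Tendsto (fun N : ℕ => (N : ℂ)⁻¹ * ∑ n ∈ Finset.range N,
            ∫ z : Circle, (z : ℂ) ^ (s n) ∂μ)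
          Filter.atTop (nhds (l : ℂ))) ∧
      (∃ l' : ℝ, 0 < l' ∧
        Filter.Tendsto (fun N : ℕ => (N : ℝ)⁻¹ * ∑ n ∈ Finset.range N,
            ‖∫ z : Circle, (z : ℂ) ^ (s n) ∂μ‖ ^ 2)
          Filter.atTop (nhds l')) := by
  have hmem : ∀ n, s n ∈ goodSet m := fun n => hrange ▸ Set.mem_range_self n
  have hGm := (isClosed_nearOneSet m).measurableSet
  obtain ⟨μ, hμ, hμ0, hμG, hμinv⟩ := exists_isProbabilityMeasure_map_inv hGm
    (not_countable_nearOneSet hpos hratio hdvd hlim) fun z hz => inv_mem_nearOneSet hz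
  have hae : ∀ᵐ z ∂μ, z ∈ nearOneSet m := hμG
  have hmeas : ∀ k : ℕ, Measurable fun z : Circle => (z : ℂ) ^ k := fun k =>
    measurable_circle_coe.pow_const k
  have hint : ∀ k : ℕ, Integrable (fun z : Circle => (z : ℂ) ^ k) μ := fun k =>
    Integrable.of_bound (hmeas k).aestronglyMeasurable 1
      (Filter.Eventually.of_forall fun x => (norm_circle_pow _ _).le)
  have hswap : ∀ k : ℕ, ∫ z : Circle, ((z⁻¹ : Circle) : ℂ) ^ k ∂μ = ∫ z : Circle, (z : ℂ) ^ k ∂μ :=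
    fun k => by
      conv_rhs => rw [← hμinv]
      rw [integral_map continuous_inv.measurable.aemeasurable (hmeas k).aestronglyMeasurable]
  have him : ∀ k : ℕ, (∫ z : Circle, (z : ℂ) ^ k ∂μ).im = 0 := fun k => by
    rw [← Complex.conj_eq_iff_im, ← integral_conj]
    conv_rhs => rw [← hswap k]
    simp only [coe_inv_pow]
  have hre : ∀ n, 1 / 2 ≤ (∫ z : Circle, (z : ℂ) ^ (s n) ∂μ).re := fun n => by
    have h := integral_mono_ae (integrable_const (1 / 2 : ℝ)) (hint (s n)).re
      (hae.mono fun z hz => half_le_re_of_mem_nearOneSet hz (hmem n))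
    have h2 : ∫ z : Circle, RCLike.re ((z : ℂ) ^ (s n)) ∂μ = _ := integral_re (hint (s n))
    rw [h2] at h
    simpa using h
  refine ⟨μ, hμ, hμ0, ?_, ?_, ?_⟩
  · refine measure_mono_null (t := (nearOneSet m)ᶜ) (fun z (hz : c z = 0) hzG => ?_) hμG
    have h := le_re_of_tendsto_average
      (fun n => half_le_re_of_mem_nearOneSet hzG (hmem n)) (hc z)
    rw [hz] at h
    norm_num at h
  · have hL := tendsto_average_integral_pow μ measurable_id hc
    simp only [id] at hL
    set L := ∫ z, c z ∂μ
    have hLim : L.im = 0 := by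
      refine tendsto_nhds_unique ((Complex.continuous_im.tendsto L).comp hL)
        (tendsto_const_nhds.congr fun N => ?_)
      rw [Function.comp_apply, show ((N : ℂ)⁻¹) = (((N : ℝ)⁻¹ : ℝ) : ℂ) by push_cast; rfl,
        Complex.im_ofReal_mul, Complex.im_sum]
      simp [him]
    refine ⟨L.re, by linarith [le_re_of_tendsto_average hre hL], ?_⟩
    rwa [show ((L.re : ℝ) : ℂ) = L from Complex.ext (by simp) (by simp [hLim])]
  · have hg : Measurable fun p : Circle × Circle => p.1 * p.2⁻¹ :=
      (continuous_fst.mul continuous_snd.inv).measurable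
    have hL := tendsto_average_integral_pow (μ.prod μ) hg hc
    have hsq : ∀ k : ℕ, ∫ p : Circle × Circle, ((p.1 * p.2⁻¹ : Circle) : ℂ) ^ k ∂(μ.prod μ) =
        ((‖∫ z : Circle, (z : ℂ) ^ k ∂μ‖ ^ 2 : ℝ) : ℂ) := fun k => by
      simp only [Circle.coe_mul, mul_pow]
      rw [integral_prod_mul (fun z : Circle => (z : ℂ) ^ k)
        (fun z : Circle => ((z⁻¹ : Circle) : ℂ) ^ k), ← Complex.normSq_eq_norm_sq,
        Complex.normSq_eq_conj_mul_self, ← integral_conj, mul_comm]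
      simp only [coe_inv_pow]
    simp only [hsq] at hL
    set L := ∫ p : Circle × Circle, c (p.1 * p.2⁻¹) ∂(μ.prod μ)
    have hquarter : ∀ n, 1 / 4 ≤
        ((‖∫ z : Circle, (z : ℂ) ^ (s n) ∂μ‖ ^ 2 : ℝ) : ℂ).re := fun n => by
      rw [Complex.ofReal_re]
      nlinarith [hre n, Complex.re_le_norm (∫ z : Circle, (z : ℂ) ^ (s n) ∂μ)]
    refine ⟨L.re, by linarith [le_re_of_tendsto_average hquarter hL], ?_⟩
    refine ((Complex.continuous_re.tendsto L).comp hL).congr fun N => ?_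
    rw [Function.comp_apply, show ((N : ℂ)⁻¹) = (((N : ℝ)⁻¹ : ℝ) : ℂ) by push_cast; rfl,
      Complex.re_ofReal_mul, Complex.re_sum]
    simp only [Complex.ofReal_re]
end

section
/- For a good sequence S = (s_n)_{n≥1} and λ ∈ S¹, there exists a probability measure ν_{S,λ} on S¹ such that ν̂_{S,λ}(m) = c_S(λ^m) for every m ∈ ℤ, and the empirical measures (1/N) Σ_{n=1}^{N} δ_{λ^{s_n}} converge weakly (in the weak* topology of probability measures on S¹) to ν_{S,λ} as N → ∞. -/
open MeasureTheory

/-- The character `z ↦ z ^ k` of the circle, as a continuous complex-valued function. -/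
noncomputable def circleMonomial (k : ℤ) : C(Circle, ℂ) where
  toFun z := ((z ^ k : Circle) : ℂ)
  continuous_toFun := continuous_subtype_val.comp (continuous_zpow k)

/-- Trigonometric polynomials are dense in the continuous functions on the circle. -/
theorem span_circleMonomial_closure_eq_top :
    (Submodule.span ℂ (Set.range circleMonomial)).topologicalClosure = ⊤ := by
  let A : StarSubalgebra ℂ C(Circle, ℂ) :=
    { toSubalgebra := Algebra.adjoin ℂ (Set.range circleMonomial)
      star_mem' := by
        change Algebra.adjoin ℂ (Set.range circleMonomial) ≤
          star (Algebra.adjoin ℂ (Set.range circleMonomial))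
        refine Algebra.adjoin_le ?_
        rintro - ⟨n, rfl⟩
        refine Algebra.subset_adjoin ⟨-n, ?_⟩
        ext z
        simp [circleMonomial, ← Circle.coe_inv_eq_conj] }
  have hA : Subalgebra.toSubmodule A.toSubalgebra =
      Submodule.span ℂ (Set.range circleMonomial) := by
    apply Algebra.adjoin_eq_span_of_subset
    refine Set.Subset.trans ?_ Submodule.subset_span
    intro x hx
    refine Submonoid.closure_induction (fun _ => id) ⟨0, ?_⟩ ?_ hx
    · ext z; simp [circleMonomial]
    · rintro - - - - ⟨m, rfl⟩ ⟨n, rfl⟩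
      refine ⟨m + n, ?_⟩
      ext z
      simp [circleMonomial, zpow_add]
  have hsep : A.SeparatesPoints := by
    intro x y hxy
    refine ⟨_, ⟨circleMonomial 1, Algebra.subset_adjoin ⟨1, rfl⟩, rfl⟩, ?_⟩
    simpa [circleMonomial, Circle.coe_inj] using hxy
  rw [← hA]
  exact congr_arg (Subalgebra.toSubmodule <| StarSubalgebra.toSubalgebra ·)
    (ContinuousMap.starSubalgebra_topologicalClosure_eq_top_of_separatesPoints A hsep)

theorem ContinuousMap.lipschitzWith_integral {X : Type*} [TopologicalSpace X] [CompactSpace X]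
    [MeasurableSpace X] [BorelSpace X] (μ : Measure X) [IsProbabilityMeasure μ] :
    LipschitzWith 1 (fun f : C(X, ℂ) => ∫ x, f x ∂μ) := by
  refine LipschitzWith.of_dist_le_mul fun f g => ?_
  have hint (h : C(X, ℂ)) : Integrable h μ :=
    h.continuous.integrable_of_hasCompactSupport (HasCompactSupport.of_compactSpace _)
  rw [dist_eq_norm, ← integral_sub (hint f) (hint g), NNReal.coe_one, one_mul, dist_eq_norm]
  simpa using norm_integral_le_of_norm_le_const (μ := μ)
    (.of_forall fun x => (f - g).norm_coe_le_norm x)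

open Filter Topology in
/-- Convergence of all Fourier coefficients implies convergence of the integrals of all
continuous functions. -/
theorem tendsto_integral_of_tendsto_integral_circleMonomial {ι : Type*} {l : Filter ι}
    {μ : ι → ProbabilityMeasure Circle} {ν : ProbabilityMeasure Circle}
    (h : ∀ k, Tendsto (fun i => ∫ w, circleMonomial k w ∂(μ i : Measure Circle)) l
      (𝓝 (∫ w, circleMonomial k w ∂(ν : Measure Circle)))) (f : C(Circle, ℂ)) :
    Tendsto (fun i => ∫ w, f w ∂(μ i : Measure Circle)) l
      (𝓝 (∫ w, f w ∂(ν : Measure Circle))) := by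
  have hint (ρ : ProbabilityMeasure Circle) (g : C(Circle, ℂ)) : Integrable g (ρ : Measure Circle) :=
    g.continuous.integrable_of_hasCompactSupport (HasCompactSupport.of_compactSpace _)
  have hclosed : IsClosed {g : C(Circle, ℂ) |
      Tendsto (fun i => ∫ w, g w ∂(μ i : Measure Circle)) l
        (𝓝 (∫ w, g w ∂(ν : Measure Circle)))} :=
    (LipschitzWith.uniformEquicontinuous _ 1 fun i =>
      ContinuousMap.lipschitzWith_integral (μ i : Measure Circle)).equicontinuous
      |>.isClosed_setOfPred_tendsto (ContinuousMap.lipschitzWith_integral _).continuous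
  have hf : f ∈ (Submodule.span ℂ (Set.range circleMonomial)).topologicalClosure := by
    simp [span_circleMonomial_closure_eq_top]
  refine closure_minimal (fun g hg => ?_) hclosed hf
  induction hg using Submodule.span_induction with
  | mem x hx => obtain ⟨k, rfl⟩ := hx; exact h k
  | zero => simpa using tendsto_const_nhds
  | add x y _ _ hx hy =>
    simpa [integral_add (hint _ x) (hint _ y)] using Tendsto.add hx hy
  | smul a x _ hx =>
    simpa [integral_const_mul] using Tendsto.const_mul a hx

open Filter Topology in
/-- A sequence of probability measures on the circle whose Fourier coefficients all converge
converges weakly to a probability measure with the limiting Fourier coefficients. -/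
theorem exists_probabilityMeasure_of_tendsto_integral_circleMonomial {ι : Type*} {l : Filter ι}
    [l.NeBot] {μ : ι → ProbabilityMeasure Circle} {c : ℤ → ℂ}
    (h : ∀ k, Tendsto (fun i => ∫ w, circleMonomial k w ∂(μ i : Measure Circle)) l (𝓝 (c k))) :
    ∃ ν : ProbabilityMeasure Circle,
      (∀ k, ∫ w, circleMonomial k w ∂(ν : Measure Circle) = c k) ∧
      ∀ f : C(Circle, ℂ), Tendsto (fun i => ∫ w, f w ∂(μ i : Measure Circle)) l
        (𝓝 (∫ w, f w ∂(ν : Measure Circle))) := by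
  obtain ⟨ν, -, hν⟩ := isCompact_univ.ultrafilter_le_nhds ((Ultrafilter.of l).map μ) (by simp)
  have hcoeff (k : ℤ) : ∫ w, circleMonomial k w ∂(ν : Measure Circle) = c k :=
    tendsto_nhds_unique
      ((ProbabilityMeasure.tendsto_iff_forall_integral_rclike_tendsto ℂ).1 hν
        (BoundedContinuousFunction.mkOfCompact (circleMonomial k)))
      ((h k).mono_left (Ultrafilter.of_le l))
  exact ⟨ν, hcoeff, tendsto_integral_of_tendsto_integral_circleMonomial
    fun k => by simpa only [hcoeff] using h k⟩

/-- The uniform probability measure on the points `x 0, …, x N`, with multiplicity. -/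
noncomputable def empiricalMeasure {X : Type*} [MeasurableSpace X] (x : ℕ → X) (N : ℕ) :
    ProbabilityMeasure X :=
  ⟨((N + 1 : ℕ) : ENNReal)⁻¹ • ∑ n ∈ Finset.range (N + 1), Measure.dirac (x n),
    ⟨by
      simp only [Measure.smul_apply, Measure.finsetSum_apply, measure_univ, Finset.sum_const,
        Finset.card_range, nsmul_eq_mul, mul_one, smul_eq_mul]
      exact ENNReal.inv_mul_cancel (by simp) (by finiteness)⟩⟩

theorem integral_empiricalMeasure {X : Type*} [MeasurableSpace X] [MeasurableSingletonClass X]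
    (x : ℕ → X) (N : ℕ) (f : X → ℂ) :
    ∫ y, f y ∂(empiricalMeasure x N : Measure X) =
      ((N + 1 : ℕ) : ℂ)⁻¹ * ∑ n ∈ Finset.range (N + 1), f (x n) := by
  simp only [empiricalMeasure, ProbabilityMeasure.coe_mk, integral_smul_measure]
  rw [integral_finsetSum_measure fun n _ => integrable_dirac (by simp)]
  simp only [integral_dirac, ENNReal.toReal_inv, ENNReal.toReal_natCast, Complex.real_smul]
  push_cast
  rfl

/-- For a good sequence `S` with limit function `c` and `λ ∈ S¹`, there is
a probability measure `ν` on `S¹` with `ν̂(m) = c(λ^m)` for all `m ∈ ℤ`, and the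
empirical measures `(1/N) ∑_{n=1}^N δ_{λ^{s_n}}` converge weakly to `ν`. -/
theorem stmt_17 (s : ℕ → ℕ) (hs : StrictMono s) (h0 : 0 < s 0)
    (c : Circle → ℂ)
    (hc : ∀ z : Circle,
      Filter.Tendsto (fun N : ℕ => (N : ℂ)⁻¹ * ∑ n ∈ Finset.range N, (z : ℂ) ^ (s n))
        Filter.atTop (nhds (c z)))
    (lam : Circle) :
    ∃ ν : Measure Circle, IsProbabilityMeasure ν ∧
      (∀ k : ℤ, ∫ w : Circle, (w : ℂ) ^ k ∂ν = c (lam ^ k)) ∧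
      ∀ f : C(Circle, ℂ),
        Filter.Tendsto (fun N : ℕ => (N : ℂ)⁻¹ * ∑ n ∈ Finset.range N, f (lam ^ (s n)))
          Filter.atTop (nhds (∫ w : Circle, f w ∂ν)) := by
  have hcoeff (k : ℤ) : Filter.Tendsto
      (fun N => ∫ w, circleMonomial k w
        ∂(empiricalMeasure (fun n => lam ^ s n) N : Measure Circle))
      Filter.atTop (nhds (c (lam ^ k))) := by
    simp only [integral_empiricalMeasure]
    refine ((Filter.tendsto_add_atTop_iff_nat 1).2 (hc (lam ^ k))).congr fun N => ?_
    congr 1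
    refine Finset.sum_congr rfl fun n _ => ?_
    change _ = (((lam ^ s n) ^ k : Circle) : ℂ)
    rw [← Circle.coe_pow, ← zpow_natCast, ← zpow_natCast, zpow_comm]
  obtain ⟨ν, hν, hlim⟩ := exists_probabilityMeasure_of_tendsto_integral_circleMonomial hcoeff
  refine ⟨ν, inferInstance, fun k => ?_, fun f => ?_⟩
  · simpa [circleMonomial] using hν k
  · refine (Filter.tendsto_add_atTop_iff_nat 1).1 ?_
    simpa only [integral_empiricalMeasure] using hlim f
end

section
/- Suppose (m_j)_{j≥1} additionally satisfies: m_j divides m_{j+1} for every j and m_{j+1}/m_j → ∞. Then there are uncountably many λ in the spectrum Λ_S such that limsup_{j→∞} |c_S(λ^{m_j})| = 1; equivalently, the weak* limit ν_{S,λ} of (1/N) Σ_{n=1}^{N} δ_{λ^{s_n}} satisfies limsup_{j→∞} |ν̂_{S,λ}(m_j)| = 1 for uncountably many λ ∈ Λ_S. -/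
open Filter Topology Real

lemma norm_circle_mul_sub_one_le (a b : Circle) :
    ‖((a * b : Circle) : ℂ) - 1‖ ≤ ‖(a : ℂ) - 1‖ + ‖(b : ℂ) - 1‖ := by
  have h : ((a * b : Circle) : ℂ) - 1 = ((a : ℂ) - 1) * b + (b - 1) := by
    push_cast
    ring
  rw [h]
  refine (norm_add_le _ _).trans ?_
  rw [norm_mul, Circle.norm_coe, mul_one]

lemma norm_circle_exp_sub_one_le (t : ℝ) : ‖(Circle.exp t : ℂ) - 1‖ ≤ |t| := by
  simpa [Circle.coe_exp, mul_comm] using Real.norm_exp_I_mul_ofReal_sub_one_le (x := t)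

section Residues

variable {m : ℕ → ℕ}

lemma two_mul_abs_sum_digits_le (hratio : ∀ j, 1 ≤ j → 3 * m j ≤ m (j + 1))
    {ω : ℕ → ℤ} (hω : ∀ j, |ω j| ≤ 1) {P : ℕ} (hP : 1 ≤ P) :
    2 * |∑ j ∈ Finset.Icc 1 P, ω j * (m j : ℤ)| ≤ 3 * m P := by
  have hterm (j : ℕ) : |ω j * (m j : ℤ)| ≤ m j := by
    rw [abs_mul, Nat.abs_cast]
    exact mul_le_of_le_one_left (by positivity) (hω j)
  induction P, hP using Nat.le_induction with
  | base =>
    have := hterm 1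
    simp only [Finset.Icc_self, Finset.sum_singleton]
    lia
  | succ P hP ih =>
    rw [Finset.sum_Icc_succ_top (by lia)]
    have h1 := abs_add_le (∑ j ∈ Finset.Icc 1 P, ω j * (m j : ℤ)) (ω (P + 1) * (m (P + 1) : ℤ))
    have h2 := hterm (P + 1)
    have h3 := hratio P hP
    lia

lemma exists_residue_of_mem_goodSet (hratio : ∀ j, 1 ≤ j → 3 * m j ≤ m (j + 1))
    (hdvd : ∀ j, 1 ≤ j → m j ∣ m (j + 1)) {x : ℕ} (hx : x ∈ goodSet m) {P : ℕ} (hP : 1 ≤ P) :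
    ∃ y : ℤ, |y| ≤ 2 * m P ∧ (m (P + 1) : ℤ) ∣ x - y := by
  obtain ⟨k, hk, ω, hω, hxk⟩ := hx
  set η : ℕ → ℤ := fun j => if j < k then ω j else if j = k then 1 else 0 with hη
  have hη1 (j : ℕ) : |η j| ≤ 1 := by
    have := hω j
    simp only [Set.mem_insert_iff, Set.mem_singleton_iff] at this
    simp only [hη]
    split_ifs
    · rcases this with h | h | h <;> simp [h]
    · simp
    · simp
  have hxη : (x : ℤ) = ∑ j ∈ Finset.Icc 1 k, η j * (m j : ℤ) := by
    obtain ⟨k, rfl⟩ : ∃ l, k = l + 1 := ⟨k - 1, by lia⟩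
    rw [Finset.sum_Icc_succ_top (by lia), hxk, add_comm]
    congr 1
    · refine Finset.sum_congr rfl fun j hj => ?_
      have : j < k + 1 := by
        have := (Finset.mem_Icc.1 hj).2
        lia
      simp only [hη, if_pos this]
    · simp [hη]
  have hext (N : ℕ) : ∑ j ∈ Finset.Icc 1 (k + N), η j * (m j : ℤ) = x := by
    induction N with
    | zero => exact hxη.symm
    | succ N ih =>
      rw [← add_assoc, Finset.sum_Icc_succ_top (by lia), ih]
      simp [hη, show ¬ k + N + 1 < k by lia, show k + N + 1 ≠ k by lia]
  have hchain (N : ℕ) : m (P + 1) ∣ m (P + 1 + N) := by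
    induction N with
    | zero => rfl
    | succ N ih => exact ih.trans (hdvd _ (by lia))
  have hdiff (N : ℕ) : (m (P + 1) : ℤ) ∣ ∑ j ∈ Finset.Icc 1 (P + N), η j * (m j : ℤ) -
      ∑ j ∈ Finset.Icc 1 P, η j * (m j : ℤ) := by
    induction N with
    | zero => simp
    | succ N ih =>
      rw [← add_assoc, Finset.sum_Icc_succ_top (by lia), add_sub_right_comm]
      refine ih.add (Dvd.dvd.mul_left ?_ _)
      have := hchain N
      rw [add_right_comm] at this
      exact_mod_cast this
  refine ⟨∑ j ∈ Finset.Icc 1 P, η j * (m j : ℤ), ?_, ?_⟩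
  · have := two_mul_abs_sum_digits_le hratio hη1 hP
    lia
  · have := hdiff k
    rwa [add_comm P k, hext] at this

end Residues

section Expansions

variable {x : ℕ → ℝ}

lemma le_mul_quarter_pow (hx4 : ∀ k, x (k + 1) ≤ x k / 4) (N i : ℕ) :
    x (N + i) ≤ x N * (1 / 4) ^ i := by
  induction i with
  | zero => simp
  | succ i ih =>
    rw [← add_assoc, pow_succ]
    linarith [hx4 (N + i)]

lemma summable_digits (hx : ∀ k, 0 < x k) (hx4 : ∀ k, x (k + 1) ≤ x k / 4)
    {d : ℕ → ℝ} (hd : ∀ k, |d k| ≤ 1) : Summable fun k => d k * x k := by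
  refine Summable.of_norm_bounded
    ((summable_geometric_of_lt_one (r := (1 / 4 : ℝ)) (by norm_num) (by norm_num)).mul_left (x 0))
    fun k => ?_
  rw [norm_mul, Real.norm_eq_abs, Real.norm_eq_abs, abs_of_pos (hx k)]
  have := le_mul_quarter_pow hx4 0 k
  rw [zero_add] at this
  exact (mul_le_of_le_one_left (hx k).le (hd k)).trans this

lemma abs_tsum_digits_mem_Ioo (hx : ∀ k, 0 < x k) (hx4 : ∀ k, x (k + 1) ≤ x k / 4)
    (hx0 : x 0 ≤ 1 / 2) {d : ℕ → ℝ} (hd : ∀ k, |d k| ≤ 1) {N : ℕ} (hN : |d N| = 1)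
    (hlt : ∀ k < N, d k = 0) : |∑' k, d k * x k| ∈ Set.Ioo 0 1 := by
  have hsum := summable_digits hx hx4 hd
  have hsplit := hsum.sum_add_tsum_nat_add (N + 1)
  rw [Finset.sum_range_succ, Finset.sum_eq_zero
    (fun k hk => by rw [hlt k (Finset.mem_range.1 hk), zero_mul]), zero_add] at hsplit
  have hgeom : HasSum (fun i : ℕ => x N / 4 * (1 / 4 : ℝ) ^ i) (x N / 3) := by
    have := (hasSum_geometric_of_lt_one (r := (1 / 4 : ℝ)) (by norm_num) (by norm_num)).mul_left
      (x N / 4)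
    rwa [show x N / 4 * (1 - 1 / 4)⁻¹ = x N / 3 by ring] at this
  have htail : |∑' i, d (i + (N + 1)) * x (i + (N + 1))| ≤ x N / 3 := by
    rw [← Real.norm_eq_abs]
    refine tsum_of_norm_bounded hgeom fun i => ?_
    rw [norm_mul, Real.norm_eq_abs, Real.norm_eq_abs, abs_of_pos (hx _)]
    refine (mul_le_of_le_one_left (hx _).le (hd _)).trans ?_
    have := le_mul_quarter_pow hx4 N (i + 1)
    rw [pow_succ, show N + (i + 1) = i + (N + 1) by ring] at this
    linarith
  have hhead : |d N * x N| = x N := by rw [abs_mul, hN, one_mul, abs_of_pos (hx N)]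
  have hxN : x N ≤ 1 / 2 := by
    have h1 := le_mul_quarter_pow hx4 0 N
    have h2 : ((1 : ℝ) / 4) ^ N ≤ 1 := pow_le_one₀ (by norm_num) (by norm_num)
    rw [zero_add] at h1
    nlinarith [hx 0]
  have hpos := hx N
  rw [← hsplit]
  set T := ∑' i, d (i + (N + 1)) * x (i + (N + 1))
  constructor
  · have := abs_sub_abs_le_abs_add (d N * x N) T
    linarith
  · have := abs_add_le (d N * x N) T
    linarith

/-- The point of the circle whose angle, in turns, is `∑ x_k` over `k ∈ A`. -/
noncomputable def circlePoint (x : ℕ → ℝ) (A : Set ℕ) : Circle :=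
  Circle.exp (2 * π * ∑' k, A.indicator 1 k * x k)

lemma abs_indicator_one_le (A : Set ℕ) (k : ℕ) : |A.indicator (1 : ℕ → ℝ) k| ≤ 1 := by
  by_cases h : k ∈ A <;> simp [h]

lemma circlePoint_injective (hx : ∀ k, 0 < x k) (hx4 : ∀ k, x (k + 1) ≤ x k / 4)
    (hx0 : x 0 ≤ 1 / 2) : Function.Injective (circlePoint x) := by
  classical
  intro A B hAB
  by_contra hne
  have hex : ∃ k, ¬ (k ∈ A ↔ k ∈ B) := by
    by_contra! h
    exact hne (Set.ext h)
  have hN := Nat.find_spec hex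
  have hlt (k : ℕ) (hk : k < Nat.find hex) := not_not.1 (Nat.find_min hex hk)
  set N := Nat.find hex
  have hmem := abs_tsum_digits_mem_Ioo hx hx4 hx0
    (d := fun k => A.indicator 1 k - B.indicator 1 k) (N := N)
    (fun k => by by_cases h1 : k ∈ A <;> by_cases h2 : k ∈ B <;> simp [h1, h2])
    (by by_cases h1 : N ∈ A <;> by_cases h2 : N ∈ B <;> simp_all)
    (fun k hk => by
      have := hlt k hk
      by_cases h1 : k ∈ A <;> by_cases h2 : k ∈ B <;> simp_all)
  simp only [sub_mul] at hmem
  rw [Summable.tsum_sub (summable_digits hx hx4 (abs_indicator_one_le A))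
    (summable_digits hx hx4 (abs_indicator_one_le B))] at hmem
  obtain ⟨n, hn⟩ := Circle.exp_eq_exp.1 hAB
  have hdiff : (∑' k, A.indicator 1 k * x k) - ∑' k, B.indicator 1 k * x k = n := by
    have := Real.pi_pos
    apply mul_left_cancel₀ (show (2 * π) ≠ 0 by positivity)
    linarith
  rw [hdiff] at hmem
  have h0 : (0 : ℤ) < |n| := by exact_mod_cast hmem.1
  have h1 : |n| < (1 : ℤ) := by exact_mod_cast hmem.2
  lia

end Expansions

lemma norm_sub_le_of_tendsto_average {u : ℕ → ℂ} {l a : ℂ} {δ : ℝ}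
    (hl : Tendsto (fun N : ℕ => (N : ℂ)⁻¹ * ∑ n ∈ Finset.range N, u n) atTop (𝓝 l))
    (hu : ∀ n, ‖u n - a‖ ≤ δ) : ‖l - a‖ ≤ δ := by
  refine le_of_tendsto (hl.sub_const a).norm ?_
  filter_upwards [eventually_gt_atTop 0] with N hN
  have hN' : (N : ℂ) ≠ 0 := by exact_mod_cast hN.ne'
  have h : (N : ℂ)⁻¹ * ∑ n ∈ Finset.range N, u n - a
      = (N : ℂ)⁻¹ * ∑ n ∈ Finset.range N, (u n - a) := by
    rw [Finset.sum_sub_distrib]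
    simp only [Finset.sum_const, Finset.card_range, nsmul_eq_mul]
    field_simp
  rw [h, norm_mul, norm_inv, Complex.norm_natCast, inv_mul_le_iff₀ (by exact_mod_cast hN)]
  refine (norm_sum_le_of_le _ fun n _ => hu n).trans ?_
  simp

/-- A sparse sequence of indices `p_k` along which `m_{p_k + 1} / m_{p_k}` grows very fast.
The value `M_k` is `1` for `k = 0` and `m_{p_{k-1} + 1}` otherwise. -/
lemma exists_sparse_indices {m : ℕ → ℕ} (hpos : ∀ j, 1 ≤ j → 0 < m j)
    (hlim : Tendsto (fun j : ℕ => (m (j + 1) : ℝ) / (m j : ℝ)) atTop atTop) :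
    ∃ (p M : ℕ → ℕ), StrictMono p ∧ (∀ k, 1 ≤ p k) ∧ M 0 = 1 ∧ (∀ k, M (k + 1) = m (p k + 1)) ∧
      ∀ k, 100 * 2 ^ k * M k * m (p k) ≤ m (p k + 1) := by
  have hstep (R a : ℕ) : ∃ j, a < j ∧ 1 ≤ j ∧ R * m j ≤ m (j + 1) := by
    obtain ⟨j, hj, haj⟩ :=
      ((hlim.eventually_ge_atTop (R : ℝ)).and (eventually_gt_atTop a)).exists
    refine ⟨j, haj, by lia, ?_⟩
    have : (0 : ℝ) < m j := by exact_mod_cast hpos j (by lia)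
    rw [le_div_iff₀ this] at hj
    exact_mod_cast hj
  choose g hg hg1 hgm using hstep
  let p : ℕ → ℕ := Nat.rec (g 100 0) fun k q => g (100 * 2 ^ (k + 1) * m (q + 1)) q
  let M : ℕ → ℕ := fun k => Nat.casesOn k 1 fun k => m (p k + 1)
  refine ⟨p, M, strictMono_nat_of_lt_succ fun k => hg _ _, ?_, rfl, fun k => rfl, ?_⟩
  · rintro (_ | k)
    · exact hg1 _ _
    · exact hg1 _ _
  · rintro (_ | k)
    · simpa [M, p] using hgm 100 0
    · exact hgm _ _

lemma norm_circlePoint_pow_sub_one_le {m p M : ℕ → ℕ} (hpos : ∀ j, 1 ≤ j → 0 < m j)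
    (hratio : ∀ j, 1 ≤ j → 3 * m j ≤ m (j + 1)) (hdvd : ∀ j, 1 ≤ j → m j ∣ m (j + 1))
    (hp : StrictMono p) (hp1 : ∀ k, 1 ≤ p k) (hMmono : Monotone M)
    (hM : ∀ k, M (k + 1) = m (p k + 1))
    (hpM : ∀ k, 100 * 2 ^ k * M k * m (p k) ≤ m (p k + 1)) {x : ℕ → ℝ}
    (hxdef : ∀ k, x k = 1 / (m (p k + 1) : ℝ))
    (hsum : ∀ A : Set ℕ, Summable fun k => A.indicator 1 k * x k)
    (A : Set ℕ) (l : ℕ) {t : ℕ} (ht : t ∈ goodSet m) :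
    ‖((circlePoint x A ^ M l : Circle) : ℂ) ^ t - 1‖ ≤ (1 / 2) ^ (l + 1) := by
  let u : ℕ → Circle := fun k => Circle.exp (2 * π * (A.indicator 1 k * x k))
  have hu1 (k : ℕ) : u k ^ m (p k + 1) = 1 := by
    have h0 : (m (p k + 1) : ℝ) ≠ 0 := by exact_mod_cast (hpos _ (by lia)).ne'
    rw [← Circle.exp_natCast_mul, hxdef]
    by_cases h : k ∈ A
    · rw [Set.indicator_of_mem h, Pi.one_apply, show (m (p k + 1) : ℝ) *
        (2 * π * (1 * (1 / (m (p k + 1) : ℝ)))) = 2 * π by field_simp, Circle.exp_two_pi]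
    · simp [h]
  have hdvdM (k : ℕ) (hk : k < l) : m (p k + 1) ∣ M l := by
    obtain ⟨l, rfl⟩ : ∃ i, l = i + 1 := ⟨l - 1, by lia⟩
    rw [hM]
    have hle : p k ≤ p l := hp.monotone (by lia)
    generalize p l = b at hle
    induction b, hle using Nat.le_induction with
    | base => rfl
    | succ j hj ih => exact ih.trans (hdvd _ (by lia))
  have hsmall (k : ℕ) (hk : l ≤ k) :
      ‖(((u k ^ M l) ^ t : Circle) : ℂ) - 1‖ ≤ 1 / 4 * (1 / 2) ^ k := by
    obtain ⟨y, hy, hdy⟩ := exists_residue_of_mem_goodSet hratio hdvd ht (hp1 k)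
    obtain ⟨q, hq⟩ := hdy
    have huy : (u k ^ M l) ^ t = Circle.exp (((M l * y : ℤ) : ℝ) *
        (2 * π * (A.indicator 1 k * x k))) := by
      rw [Circle.exp_intCast_mul, ← pow_mul, ← zpow_natCast,
        show ((M l * t : ℕ) : ℤ) = M l * y + (m (p k + 1) : ℕ) * (q * M l) by
          push_cast
          linear_combination (M l : ℤ) * hq,
        zpow_add, zpow_mul _ ((m (p k + 1) : ℕ) : ℤ), zpow_natCast, hu1]
      simp [u]
    rw [huy]
    refine (norm_circle_exp_sub_one_le _).trans ?_
    have hX : (0 : ℝ) < m (p k + 1) := by exact_mod_cast hpos _ (by lia)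
    have hxk : 0 < x k := by
      rw [hxdef]
      positivity
    have hyR : |(y : ℝ)| ≤ 2 * m (p k) := by exact_mod_cast hy
    have hMlk : (M l : ℝ) ≤ M k := by exact_mod_cast hMmono hk
    have hpMR : (100 : ℝ) * 2 ^ k * M k * m (p k) ≤ m (p k + 1) := by exact_mod_cast hpM k
    push_cast
    rw [abs_mul, abs_mul, abs_mul (2 * π), abs_mul (A.indicator 1 k), abs_of_pos hxk,
      Nat.abs_cast, abs_of_pos (show 0 < 2 * π by positivity)]
    calc (M l : ℝ) * |(y : ℝ)| * (2 * π * (|A.indicator 1 k| * x k))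
        ≤ M k * (2 * m (p k)) * (2 * 4 * (1 * x k)) := by
          gcongr
          · exact Real.pi_le_four
          · exact abs_indicator_one_le A k
      _ = 16 * (M k * m (p k)) / m (p k + 1) := by
          rw [hxdef]
          ring
      _ ≤ 1 / 4 * (1 / 2) ^ k := by
          rw [div_le_iff₀ hX, one_div_pow]
          have h2 : (0 : ℝ) < 2 ^ k := by positivity
          have h3 : (0 : ℝ) ≤ M k * m (p k) := by positivity
          rw [show 1 / 4 * (1 / 2 ^ k) * (m (p k + 1) : ℝ) = (m (p k + 1) : ℝ) / (4 * 2 ^ k) by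
            field_simp, le_div_iff₀ (by positivity)]
          nlinarith
  let z : ℕ → Circle := fun R => ∏ k ∈ Finset.range R, u k
  have hz (R : ℕ) : ‖(((z (l + R) ^ M l) ^ t : Circle) : ℂ) - 1‖
      ≤ (1 / 2) ^ (l + 1) - (1 / 2) ^ (l + R + 1) := by
    induction R with
    | zero =>
      have h1 : z l ^ M l = 1 := by
        simp only [z]
        rw [← Finset.prod_pow]
        refine Finset.prod_eq_one fun k hk => ?_
        obtain ⟨q, hq⟩ := hdvdM k (Finset.mem_range.1 hk)
        rw [hq, pow_mul, hu1, one_pow]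
      simp [h1]
    | succ R ih =>
      have h1 : (z (l + (R + 1)) ^ M l) ^ t
          = (z (l + R) ^ M l) ^ t * (u (l + R) ^ M l) ^ t := by
        simp only [z]
        rw [← add_assoc, Finset.prod_range_succ, mul_pow, mul_pow]
      rw [h1]
      refine (norm_circle_mul_sub_one_le _ _).trans ?_
      have h2 := hsmall (l + R) (by lia)
      rw [← add_assoc, pow_succ _ (l + R + 1), pow_succ _ (l + R)] at *
      linarith
  have hzlim : Tendsto z atTop (𝓝 (circlePoint x A)) := by
    have h1 : z = fun R => Circle.exp (2 * π * ∑ k ∈ Finset.range R, A.indicator 1 k * x k) := by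
      funext R
      simp only [z, u, Finset.mul_sum]
      induction R with
      | zero => simp
      | succ R ih => rw [Finset.prod_range_succ, Finset.sum_range_succ, Circle.exp_add, ih]
    rw [h1]
    exact (Circle.exp.continuous.tendsto _).comp ((hsum A).hasSum.tendsto_sum_nat.const_mul _)
  have hcont : Continuous fun w : Circle => ‖(((w ^ M l) ^ t : Circle) : ℂ) - 1‖ := by fun_prop
  rw [← Circle.coe_pow]
  refine le_of_tendsto ((hcont.tendsto _).comp
    (hzlim.comp (tendsto_add_atTop_nat l))) (Eventually.of_forall fun R => ?_)
  have := hz R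
  have h2 : (0 : ℝ) ≤ (1 / 2) ^ (l + R + 1) := by positivity
  simp only [Function.comp_apply]
  rw [add_comm R l]
  linarith

/-- If moreover `m_j ∣ m_{j+1}` and `m_{j+1}/m_j → ∞`, there are
uncountably many `λ` in the spectrum `Λ_S` with `limsup_j |c_S(λ^{m_j})| = 1`. -/
theorem stmt_18 (m : ℕ → ℕ) (hpos : ∀ j, 1 ≤ j → 0 < m j)
    (hmono : ∀ j, 1 ≤ j → m j < m (j + 1))
    (hratio : ∀ j, 1 ≤ j → 3 * m j ≤ m (j + 1))
    (hdvd : ∀ j, 1 ≤ j → m j ∣ m (j + 1))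
    (hlim : Filter.Tendsto (fun j : ℕ => (m (j + 1) : ℝ) / (m j : ℝ))
      Filter.atTop Filter.atTop)
    (s : ℕ → ℕ) (hs : StrictMono s) (hrange : Set.range s = goodSet m)
    (c : Circle → ℂ)
    (hc : ∀ z : Circle,
      Filter.Tendsto (fun N : ℕ => (N : ℂ)⁻¹ * ∑ n ∈ Finset.range N, (z : ℂ) ^ (s n))
        Filter.atTop (nhds (c z))) :
    ¬ Set.Countable {z : Circle | c z ≠ 0 ∧
      Filter.limsup (fun j : ℕ => ‖c (z ^ (m (j + 1)))‖) Filter.atTop = 1} := by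
  obtain ⟨p, M, hp, hp1, hM0, hM, hpM⟩ := exists_sparse_indices hpos hlim
  have hMpos (k : ℕ) : 0 < M k := by
    cases k with
    | zero => simp [hM0]
    | succ k =>
      rw [hM]
      exact hpos _ (by lia)
  have hMstep (k : ℕ) : 100 * M k ≤ M (k + 1) := by
    rw [hM]
    refine le_trans ?_ (hpM k)
    have h1 := hpos _ (hp1 k)
    have h2 : 0 < 2 ^ k := by positivity
    calc 100 * M k = 100 * 1 * M k * 1 := by ring
      _ ≤ 100 * 2 ^ k * M k * m (p k) := by gcongr <;> lia
  have hMmono : Monotone M := monotone_nat_of_le_succ fun k => by linarith [hMstep k]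
  let x : ℕ → ℝ := fun k => 1 / (m (p k + 1) : ℝ)
  have hxM (k : ℕ) : x k = 1 / (M (k + 1) : ℝ) := by rw [hM]
  have hMR (k : ℕ) : (0 : ℝ) < M k := by exact_mod_cast hMpos k
  have hMstepR (k : ℕ) : 100 * (M k : ℝ) ≤ M (k + 1) := by exact_mod_cast hMstep k
  have hx (k : ℕ) : 0 < x k := by
    rw [hxM]
    have := hMR (k + 1)
    positivity
  have hx4 (k : ℕ) : x (k + 1) ≤ x k / 4 := by
    rw [hxM, hxM, div_div]
    have := hMR (k + 1)
    exact one_div_le_one_div_of_le (by positivity) (by linarith [hMstepR (k + 1)])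
  have hx0 : x 0 ≤ 1 / 2 := by
    rw [hxM]
    have h1 := hMstepR 0
    rw [hM0] at h1
    push_cast at h1
    exact one_div_le_one_div_of_le (by norm_num) (by linarith)
  have hclose (A : Set ℕ) (l : ℕ) : ‖c (circlePoint x A ^ M l) - 1‖ ≤ (1 / 2) ^ (l + 1) :=
    norm_sub_le_of_tendsto_average (hc _) fun n =>
      norm_circlePoint_pow_sub_one_le hpos hratio hdvd hp hp1 hMmono hM hpM (fun _ => rfl)
        (fun B => summable_digits hx hx4 (abs_indicator_one_le B)) A l
        (hrange ▸ Set.mem_range_self n)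
  have hle (z : Circle) : ‖c z‖ ≤ 1 := by
    simpa using norm_sub_le_of_tendsto_average (a := 0) (δ := 1) (hc z) fun n => by
      rw [sub_zero, norm_pow, Circle.norm_coe, one_pow]
  have hbdd (z : Circle) : IsBoundedUnder (· ≤ ·) atTop fun j : ℕ => ‖c (z ^ m (j + 1))‖ :=
    isBoundedUnder_of ⟨1, fun j => hle _⟩
  have hcobdd (z : Circle) : IsCoboundedUnder (· ≤ ·) atTop fun j : ℕ => ‖c (z ^ m (j + 1))‖ :=
    (isBoundedUnder_of ⟨0, fun j => norm_nonneg _⟩ :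
      IsBoundedUnder (· ≥ ·) atTop _).isCoboundedUnder_le
  have hmem (A : Set ℕ) : circlePoint x A ∈ {z : Circle | c z ≠ 0 ∧
      Filter.limsup (fun j : ℕ => ‖c (z ^ (m (j + 1)))‖) Filter.atTop = 1} := by
    refine ⟨fun h0 => ?_, le_antisymm ?_ ?_⟩
    · have := hclose A 0
      rw [hM0, pow_one, h0] at this
      norm_num at this
    · exact limsup_le_of_le (hcobdd _) (Eventually.of_forall fun j => hle _)
    · refine le_of_forall_lt fun b hb => ?_
      obtain ⟨b', hbb', hb'⟩ := exists_between hb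
      refine hbb'.trans_le (le_limsup_of_frequently_le ?_ (hbdd _))
      have hev : ∀ᶠ l : ℕ in atTop, ((1 : ℝ) / 2) ^ l < 1 - b' :=
        (tendsto_pow_atTop_nhds_zero_of_lt_one (by norm_num) (by norm_num)).eventually_lt_const
          (by linarith)
      refine hp.tendsto_atTop.frequently (Eventually.frequently ?_)
      filter_upwards [(tendsto_add_atTop_nat 2).eventually hev] with l hl
      have h1 := hclose A (l + 1)
      rw [hM] at h1
      have h2 := norm_sub_norm_le (1 : ℂ) (c (circlePoint x A ^ m (p l + 1)))
      rw [norm_sub_rev, norm_one] at h2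
      linarith
  intro hcount
  have hcS : (Set.univ : Set (Set ℕ)).Countable :=
    Set.countable_of_injective_of_countable_image
      (circlePoint_injective hx hx4 hx0).injOn
      (hcount.mono (by rintro _ ⟨A, -, rfl⟩; exact hmem A))
  have : Countable (Set ℕ) := Set.countable_univ_iff.1 hcS
  obtain ⟨f, hf⟩ := exists_injective_nat (Set ℕ)
  exact Function.cantor_injective f hf
end

section
/- Suppose (m_{j_k})_{k≥1} is a subsequence of (m_j)_{j≥1} with j_1 > 1 and m_j/m_{j-1} > 2^{k+2} m_{j_{k-1}} for all j ≥ j_k whenever k > 1 (and m_j/m_{j-1} > 2^{3} for all j ≥ j_1). Then for every η ∈ {0,1}^{ℕ*} and θ = θ(η) = Σ_{k=1}^{∞} η_k/m_{j_k}, one has Σ_{j=1}^{∞} ‖m_{j_n} m_j θ‖² → 0 as n → ∞; consequently L(m_{j_n} θ) → 1 as n → ∞, where L(θ) = lim_{k→∞} ∏_{j=1}^{k-1} (1 + 2cos(2π m_j θ))/3. -/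
theorem nint_eq_norm (t : ℝ) : nint t = ‖(t : UnitAddCircle)‖ :=
  (UnitAddCircle.norm_eq).symm

theorem nint_nonneg (t : ℝ) : 0 ≤ nint t := abs_nonneg _

theorem nint_sq_le (t : ℝ) : nint t ^ 2 ≤ nint t := by
  have h : nint t ≤ 1 / 2 := abs_sub_round t
  nlinarith [nint_nonneg t]

theorem nint_intCast (z : ℤ) : nint (z : ℝ) = 0 := by
  simp [nint]

theorem nint_le_abs (t : ℝ) : nint t ≤ |t| := by
  simpa [nint] using round_le t 0

theorem nint_le_of_hasSum {b c : ℕ → ℝ} {s S : ℝ} (hb : HasSum b s) (hc : HasSum c S)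
    (h : ∀ k, nint (b k) ≤ c k) : nint s ≤ S := by
  have h1 : HasSum (fun k => (b k : UnitAddCircle)) (s : UnitAddCircle) :=
    hb.map (QuotientAddGroup.mk' (AddSubgroup.zmultiples (1 : ℝ)))
      (AddCircle.continuous_mk' (1 : ℝ))
  rw [nint_eq_norm, ← h1.tsum_eq]
  exact tsum_of_norm_bounded hc fun k => by rw [← nint_eq_norm]; exact h k

theorem one_sub_cos_two_pi_mul_le (t : ℝ) :
    1 - Real.cos (2 * Real.pi * t) ≤ 2 * Real.pi ^ 2 * nint t ^ 2 := by
  have h1 : Real.cos (2 * Real.pi * t) = Real.cos (2 * Real.pi * (t - round t)) := by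
    rw [← Real.cos_sub_int_mul_two_pi _ (round t)]
    ring_nf
  have h2 := Real.one_sub_sq_div_two_le_cos (x := 2 * Real.pi * (t - round t))
  rw [h1, nint, sq_abs]
  linarith [mul_pow (2 * Real.pi) (t - round t) 2, mul_pow 2 Real.pi 2]

theorem abs_one_sub_prod_le {ι : Type*} (s : Finset ι) (p : ι → ℝ) (hp : ∀ i, |p i| ≤ 1) :
    |1 - ∏ i ∈ s, p i| ≤ ∑ i ∈ s, |1 - p i| := by
  classical
  induction s using Finset.induction_on with
  | empty => simp
  | insert a s ha ih =>
    rw [Finset.prod_insert ha, Finset.sum_insert ha]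
    calc |1 - p a * ∏ i ∈ s, p i| = |(1 - p a) + p a * (1 - ∏ i ∈ s, p i)| := by ring_nf
      _ ≤ |1 - p a| + |p a * (1 - ∏ i ∈ s, p i)| := abs_add_le _ _
      _ ≤ |1 - p a| + ∑ i ∈ s, |1 - p i| := by
        rw [abs_mul]
        have := mul_le_of_le_one_left (abs_nonneg (1 - ∏ i ∈ s, p i)) (hp a)
        linarith

theorem abs_one_add_two_cos_div_three_le (x : ℝ) : |(1 + 2 * Real.cos x) / 3| ≤ 1 := by
  rw [abs_le]
  constructor <;> linarith [Real.neg_one_le_cos x, Real.cos_le_one x]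

theorem abs_one_sub_cos_factor_le (t : ℝ) :
    |1 - (1 + 2 * Real.cos (2 * Real.pi * t)) / 3| ≤ 4 / 3 * Real.pi ^ 2 * nint t ^ 2 := by
  have h := one_sub_cos_two_pi_mul_le t
  rw [abs_of_nonneg (by linarith [Real.cos_le_one (2 * Real.pi * t)])]
  linarith

theorem sum_range_le_two_mul {m : ℕ → ℕ} (hratio : ∀ j, 1 ≤ j → 3 * m j ≤ m (j + 1)) (p : ℕ) :
    ∑ i ∈ Finset.range p, m (i + 1) ≤ 2 * m p := by
  induction p with
  | zero => simp
  | succ p ih =>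
    rw [Finset.sum_range_succ]
    rcases Nat.eq_zero_or_pos p with rfl | hp
    · simp; omega
    · have := hratio p hp
      omega

/-- The sum over `i` of the distances to `ℤ` decays geometrically in `n`. -/
theorem sum_nint_le (m : ℕ → ℕ) (hpos : ∀ j, 1 ≤ j → 0 < m j)
    (hratio : ∀ j, 1 ≤ j → 3 * m j ≤ m (j + 1))
    (hdvd : ∀ j, 1 ≤ j → m j ∣ m (j + 1))
    (jj : ℕ → ℕ) (hjj : ∀ k, 1 ≤ k → jj k < jj (k + 1)) (hj1 : 1 < jj 1)
    (hgap : ∀ k, 1 < k → ∀ i, jj k ≤ i → 2 ^ (k + 2) * m (jj (k - 1)) * m (i - 1) < m i)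
    (η : ℕ → ℕ) (hη : ∀ k, 1 ≤ k → η k ≤ 1) (n : ℕ) (hn : 1 ≤ n) (I : ℕ) :
    ∑ i ∈ Finset.range I, nint ((m (jj n) : ℝ) * (m (i + 1) : ℝ) *
      ∑' k : ℕ, (η (k + 1) : ℝ) / (m (jj (k + 1)) : ℝ)) ≤ 3 * (3 / 4) ^ n := by
  have hjmono : ∀ a b, 1 ≤ a → a ≤ b → jj a ≤ jj b := by
    intro a b ha hab
    induction b, hab using Nat.le_induction with
    | base => exact le_rfl
    | succ b hb ih => exact ih.trans (hjj b (ha.trans hb)).le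
  have hj2 : ∀ k, 1 ≤ k → 2 ≤ jj k := fun k hk => hj1.trans_le (hjmono 1 k le_rfl hk)
  have hmdvd : ∀ a b, 1 ≤ a → a ≤ b → m a ∣ m b := by
    intro a b ha hab
    induction b, hab using Nat.le_induction with
    | base => exact dvd_rfl
    | succ b hb ih => exact ih.trans (hdvd b (ha.trans hb))
  have hMpos : ∀ k, 1 ≤ k → 0 < m (jj k) := fun k hk => hpos _ (by have := hj2 k hk; omega)
  have hMposR : ∀ k, (0 : ℝ) < m (jj (k + 1)) := fun k => by
    exact_mod_cast hMpos (k + 1) (by omega)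
  have hgap' : ∀ k, 1 ≤ k → 2 ^ (k + 3) * m (jj k) * m (jj (k + 1) - 1) < m (jj (k + 1)) :=
    fun k hk => hgap (k + 1) (by omega) _ le_rfl
  have hbig : ∀ k, 2 ^ k ≤ m (jj (k + 1)) := by
    intro k
    rcases Nat.eq_zero_or_pos k with rfl | hk
    · exact hMpos 1 le_rfl
    · have h1 := hMpos k hk
      have h2 : 0 < m (jj (k + 1) - 1) := hpos _ (by have := hj2 (k + 1) (by omega); omega)
      calc 2 ^ k ≤ 2 ^ (k + 3) := Nat.pow_le_pow_right (by norm_num) (by omega)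
        _ ≤ 2 ^ (k + 3) * (m (jj k) * m (jj (k + 1) - 1)) :=
          Nat.le_mul_of_pos_right _ (Nat.mul_pos h1 h2)
        _ ≤ m (jj (k + 1)) := by rw [← mul_assoc]; exact (hgap' k hk).le
  have hsum : Summable fun k : ℕ => (η (k + 1) : ℝ) / (m (jj (k + 1)) : ℝ) := by
    refine Summable.of_nonneg_of_le (fun k => by positivity) (fun k => ?_) summable_geometric_two
    rw [one_div, inv_pow, ← one_div]
    gcongr
    · exact_mod_cast hη (k + 1) (by omega)
    · exact_mod_cast hbig k
  let c : ℕ → ℕ → ℝ := fun i k =>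
    if n ≤ k ∧ i + 1 < jj (k + 1) then (m (jj n) : ℝ) * m (i + 1) / m (jj (k + 1)) else 0
  have hc0 : ∀ i k, 0 ≤ c i k := by
    intro i k
    dsimp only [c]
    split_ifs <;> positivity
  have hcsum : ∀ J k, ∑ i ∈ Finset.range J, c i k ≤ (3 / 4) ^ n * (2 / 3) ^ k := by
    intro J k
    by_cases hk : n ≤ k
    · have h1 : ∑ i ∈ Finset.range J, c i k ≤
          ∑ i ∈ Finset.range (jj (k + 1) - 1), (m (jj n) : ℝ) * m (i + 1) / m (jj (k + 1)) := by
        have : ∀ i, c i k = if i + 1 < jj (k + 1) then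
            (m (jj n) : ℝ) * m (i + 1) / m (jj (k + 1)) else 0 := fun i => by simp [c, hk]
        simp_rw [this]
        rw [← Finset.sum_filter]
        refine Finset.sum_le_sum_of_subset_of_nonneg (fun i hi => ?_) (fun i _ _ => by positivity)
        simp only [Finset.mem_filter, Finset.mem_range] at hi ⊢
        omega
      refine h1.trans ?_
      rw [← Finset.sum_div, ← Finset.mul_sum, div_le_iff₀ (hMposR k)]
      have h2 : (∑ i ∈ Finset.range (jj (k + 1) - 1), (m (i + 1) : ℝ)) ≤
          2 * m (jj (k + 1) - 1) := by
        exact_mod_cast sum_range_le_two_mul hratio (jj (k + 1) - 1)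
      have h3 : (m (jj n) : ℝ) ≤ m (jj k) := by
        exact_mod_cast Nat.le_of_dvd (hMpos k (hn.trans hk))
          (hmdvd _ _ (by have := hj2 n hn; omega) (hjmono n k hn hk))
      have h4 : (2 : ℝ) ^ (k + 3) * m (jj k) * m (jj (k + 1) - 1) ≤ m (jj (k + 1)) := by
        exact_mod_cast (hgap' k (hn.trans hk)).le
      have h5 : (1 / 2 : ℝ) ^ k ≤ (3 / 4) ^ n * (2 / 3) ^ k := by
        calc (1 / 2 : ℝ) ^ k = (3 / 4) ^ k * (2 / 3) ^ k := by rw [← mul_pow]; norm_num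
          _ ≤ (3 / 4) ^ n * (2 / 3) ^ k := by
            gcongr ?_ * _
            exact pow_le_pow_of_le_one (by norm_num) (by norm_num) hk
      calc (m (jj n) : ℝ) * ∑ i ∈ Finset.range (jj (k + 1) - 1), (m (i + 1) : ℝ)
          ≤ m (jj k) * (2 * m (jj (k + 1) - 1)) := by gcongr
        _ ≤ (1 / 2) ^ k * (2 ^ (k + 3) * m (jj k) * m (jj (k + 1) - 1)) := by
          have : (1 / 2 : ℝ) ^ k * 2 ^ (k + 3) = 8 := by
            rw [pow_add, ← mul_assoc, ← mul_pow]; norm_num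
          have h6 : (0 : ℝ) ≤ m (jj k) * m (jj (k + 1) - 1) := by positivity
          calc _ ≤ 8 * ((m (jj k) : ℝ) * m (jj (k + 1) - 1)) := by linarith
            _ = _ := by rw [← this]; ring
        _ ≤ (3 / 4) ^ n * (2 / 3) ^ k * m (jj (k + 1)) := by gcongr
    · rw [Finset.sum_eq_zero fun i _ => by simp [c, hk]]
      positivity
  have hgeo : HasSum (fun k : ℕ => ((3 : ℝ) / 4) ^ n * (2 / 3) ^ k) ((3 / 4) ^ n * 3) := by
    have := hasSum_geometric_of_lt_one (r := (2 / 3 : ℝ)) (by norm_num) (by norm_num)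
    rw [show (1 - 2 / 3 : ℝ)⁻¹ = 3 by norm_num] at this
    exact this.mul_left _
  have hcS : ∀ i, Summable (c i) := fun i =>
    Summable.of_nonneg_of_le (hc0 i) (fun k =>
      (Finset.single_le_sum (f := fun i => c i k) (fun i _ => hc0 i k)
        (Finset.self_mem_range_succ i)).trans (hcsum (i + 1) k)) hgeo.summable
  have hterm : ∀ i, nint ((m (jj n) : ℝ) * (m (i + 1) : ℝ) *
      ∑' k : ℕ, (η (k + 1) : ℝ) / (m (jj (k + 1)) : ℝ)) ≤ ∑' k, c i k := by
    intro i
    refine nint_le_of_hasSum (hsum.hasSum.mul_left _) (hcS i).hasSum fun k => ?_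
    by_cases hk : n ≤ k ∧ i + 1 < jj (k + 1)
    · simp only [c, if_pos hk]
      refine (nint_le_abs _).trans ?_
      rw [abs_of_nonneg (by positivity), ← mul_div_assoc]
      refine div_le_div_of_nonneg_right (mul_le_of_le_one_right (by positivity) ?_) (hMposR k).le
      exact_mod_cast hη (k + 1) (by omega)
    · simp only [c, if_neg hk]
      have hd : m (jj (k + 1)) ∣ m (jj n) * m (i + 1) := by
        have h2 := hj2 (k + 1) (by omega)
        by_cases hnk : n ≤ k
        · exact Dvd.dvd.mul_left (hmdvd _ _ (by omega) (by omega)) _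
        · exact Dvd.dvd.mul_right (hmdvd _ _ (by omega) (hjmono _ _ (by omega) (by omega))) _
      obtain ⟨q, hq⟩ := hd
      have : (m (jj n) : ℝ) * m (i + 1) * ((η (k + 1) : ℝ) / m (jj (k + 1))) =
          ((q * η (k + 1) : ℕ) : ℤ) := by
        have hq' : (m (jj n) : ℝ) * m (i + 1) = m (jj (k + 1)) * q := by exact_mod_cast hq
        have := (hMposR k).ne'
        rw [hq']
        push_cast
        field_simp
      rw [this, nint_intCast]
  calc _ ≤ ∑ i ∈ Finset.range I, ∑' k, c i k := Finset.sum_le_sum fun i _ => hterm i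
    _ = ∑' k, ∑ i ∈ Finset.range I, c i k := (Summable.tsum_finsetSum fun i _ => hcS i).symm
    _ ≤ ∑' k, ((3 : ℝ) / 4) ^ n * (2 / 3) ^ k :=
      (summable_sum fun i _ => hcS i).tsum_le_tsum (hcsum I) hgeo.summable
    _ = 3 * (3 / 4) ^ n := by rw [hgeo.tsum_eq, mul_comm]

/-- For a subsequence `(m_{j_k})` with `j_1 > 1`, `m_j/m_{j-1} > 2^3` for
`j ≥ j_1`, and `m_j/m_{j-1} > 2^{k+2} m_{j_{k-1}}` for `j ≥ j_k`, `k > 1`, and any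
`η ∈ {0,1}^{ℕ*}`, `θ = θ(η) = ∑_k η_k/m_{j_k}` satisfies
`∑_j ‖m_{j_n} m_j θ‖² → 0` as `n → ∞`; consequently `L(m_{j_n} θ) → 1`. -/
theorem stmt_19 (m : ℕ → ℕ) (hpos : ∀ j, 1 ≤ j → 0 < m j)
    (hmono : ∀ j, 1 ≤ j → m j < m (j + 1))
    (hratio : ∀ j, 1 ≤ j → 3 * m j ≤ m (j + 1))
    (hdvd : ∀ j, 1 ≤ j → m j ∣ m (j + 1))
    (hlim : Filter.Tendsto (fun j : ℕ => (m (j + 1) : ℝ) / (m j : ℝ))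
      Filter.atTop Filter.atTop)
    (jj : ℕ → ℕ) (hjj : ∀ k, 1 ≤ k → jj k < jj (k + 1)) (hj1 : 1 < jj 1)
    (hgap1 : ∀ i, jj 1 ≤ i → 2 ^ 3 * m (i - 1) < m i)
    (hgap : ∀ k, 1 < k → ∀ i, jj k ≤ i → 2 ^ (k + 2) * m (jj (k - 1)) * m (i - 1) < m i)
    (η : ℕ → ℕ) (hη : ∀ k, 1 ≤ k → η k ≤ 1)
    (θ : ℝ) (hθ : θ = ∑' k : ℕ, (η (k + 1) : ℝ) / (m (jj (k + 1)) : ℝ)) :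
    (∀ n, 1 ≤ n → Summable (fun i : ℕ =>
      nint ((m (jj n) : ℝ) * (m (i + 1) : ℝ) * θ) ^ 2)) ∧
    Filter.Tendsto (fun n : ℕ => ∑' i : ℕ,
        nint ((m (jj n) : ℝ) * (m (i + 1) : ℝ) * θ) ^ 2)
      Filter.atTop (nhds 0) ∧
    (∀ L : ℕ → ℝ,
      (∀ n, 1 ≤ n →
        Filter.Tendsto (fun k : ℕ => ∏ j ∈ Finset.Icc 1 (k - 1),
            (1 + 2 * Real.cos (2 * Real.pi * (m j : ℝ) * ((m (jj n) : ℝ) * θ))) / 3)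
          Filter.atTop (nhds (L n))) →
      Filter.Tendsto L Filter.atTop (nhds 1)) := by
  have hbd : ∀ n, 1 ≤ n → ∀ I, ∑ i ∈ Finset.range I,
      nint ((m (jj n) : ℝ) * (m (i + 1) : ℝ) * θ) ^ 2 ≤ 3 * (3 / 4) ^ n := by
    intro n hn I
    rw [hθ]
    exact (Finset.sum_le_sum fun i _ => nint_sq_le _).trans
      (sum_nint_le m hpos hratio hdvd jj hjj hj1 hgap η hη n hn I)
  have hlim0 : Filter.Tendsto (fun n : ℕ => (3 : ℝ) * (3 / 4) ^ n) Filter.atTop (nhds 0) := by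
    simpa using (tendsto_pow_atTop_nhds_zero_of_lt_one
      (r := (3 / 4 : ℝ)) (by norm_num) (by norm_num)).const_mul 3
  refine ⟨fun n hn => summable_of_sum_range_le (fun i => sq_nonneg _) (hbd n hn), ?_, ?_⟩
  · refine tendsto_of_tendsto_of_tendsto_of_le_of_le' tendsto_const_nhds hlim0
      (Filter.Eventually.of_forall fun n => tsum_nonneg fun i => sq_nonneg _) ?_
    filter_upwards [Filter.eventually_ge_atTop 1] with n hn
    exact Real.tsum_le_of_sum_range_le (fun i => sq_nonneg _) (hbd n hn)
  · intro L hL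
    have hLbd : ∀ n, 1 ≤ n → |1 - L n| ≤ 4 / 3 * Real.pi ^ 2 * (3 * (3 / 4) ^ n) := by
      intro n hn
      refine le_of_tendsto ((tendsto_const_nhds.sub (hL n hn)).abs)
        (Filter.Eventually.of_forall fun k => ?_)
      refine (abs_one_sub_prod_le _ _ fun j => abs_one_add_two_cos_div_three_le _).trans ?_
      calc _ ≤ ∑ j ∈ Finset.Icc 1 (k - 1),
            4 / 3 * Real.pi ^ 2 * nint ((m (jj n) : ℝ) * (m j : ℝ) * θ) ^ 2 := by
            refine Finset.sum_le_sum fun j _ => ?_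
            rw [show 2 * Real.pi * (m j : ℝ) * ((m (jj n) : ℝ) * θ) =
              2 * Real.pi * ((m (jj n) : ℝ) * (m j : ℝ) * θ) by ring]
            exact abs_one_sub_cos_factor_le _
        _ = 4 / 3 * Real.pi ^ 2 * ∑ i ∈ Finset.range (k - 1),
            nint ((m (jj n) : ℝ) * (m (i + 1) : ℝ) * θ) ^ 2 := by
            rw [← Finset.mul_sum, Finset.range_eq_Ico, Finset.sum_Ico_add'
              (fun j => nint ((m (jj n) : ℝ) * (m j : ℝ) * θ) ^ 2) 0 (k - 1) 1]
            rfl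
        _ ≤ _ := by gcongr; exact hbd n hn _
    rw [tendsto_iff_dist_tendsto_zero]
    refine squeeze_zero' (Filter.Eventually.of_forall fun n => dist_nonneg) ?_
      (by simpa using hlim0.const_mul (4 / 3 * Real.pi ^ 2))
    filter_upwards [Filter.eventually_ge_atTop 1] with n hn
    rw [dist_comm, Real.dist_eq]
    exact hLbd n hn
end
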